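/- arXiv:2507.12397 — 16 statements merged into one kernel-verified Lean document; each statement's English description precedes it below -/
import Mathlib

section
/- Let p ≥ 3 be a prime and let x, y be integers with x² − 2 = y^p and y ≠ −1. Then x and y are both odd, y ≡ 7 (mod 8), and every prime q dividing y satisfies q ≡ 1 (mod 8) or q ≡ 7 (mod 8). -/
theorem elementary1 (p : ℕ) (hp : p.Prime) (hp3 : 3 ≤ p)
    (x y : ℤ) (h : x ^ 2 - 2 = y ^ p) (hy : y ≠ -1) :
    Odd x ∧ Odd y ∧ y ≡ 7 [ZMOD 8] ∧
    (∀ q : ℕ, q.Prime → (q : ℤ) ∣ y → q ≡ 1 [MOD 8] ∨ q ≡ 7 [MOD 8]) := by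
  obtain ⟨k, hk⟩ : Odd p := hp.odd_of_ne_two (by omega)
  have hx : Odd x := by
    by_contra hx
    rw [Int.not_odd_iff_even] at hx
    have h1 : Even (y ^ p) := by
      rw [← h]
      exact (hx.pow_of_ne_zero two_ne_zero).sub even_two
    have h2 : Even y := (Int.even_pow.1 h1).1
    have h3 : (2 : ℤ) ^ 2 ∣ y ^ p :=
      (pow_dvd_pow_of_dvd h2.two_dvd 2).trans (pow_dvd_pow y (by omega))
    have h4 : (2 : ℤ) ^ 2 ∣ x ^ 2 := pow_dvd_pow_of_dvd hx.two_dvd 2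
    omega
  have hyo : Odd y := by
    have h1 : Odd (y ^ p) := by
      rw [← h]
      exact hx.pow.sub_even even_two
    exact (Int.odd_pow.1 h1).resolve_right (by omega)
  have hx8 : x ^ 2 ≡ 1 [ZMOD 8] := (Int.modEq_iff_dvd.2 (Int.eight_dvd_sq_sub_one_of_odd hx)).symm
  have hy8 : y ^ 2 ≡ 1 [ZMOD 8] := (Int.modEq_iff_dvd.2 (Int.eight_dvd_sq_sub_one_of_odd hyo)).symm
  refine ⟨hx, hyo, ?_, ?_⟩
  · have h1 : y ^ p ≡ y [ZMOD 8] := by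
      rw [hk, pow_succ, pow_mul]
      simpa using (hy8.pow k).mul_right y
    rw [← h] at h1
    unfold Int.ModEq at *
    omega
  · intro q hq hqy
    have : Fact q.Prime := ⟨hq⟩
    have hq2 : q ≠ 2 := by
      rintro rfl
      obtain ⟨a, ha⟩ := hyo
      omega
    have h8 : q % 8 = 1 ∨ q % 8 = 7 := by
      rw [← ZMod.exists_sq_eq_two_iff hq2]
      refine ⟨(x : ZMod q), ?_⟩
      have h1 : ((x ^ 2 - 2 : ℤ) : ZMod q) = 0 := by
        rw [h, ZMod.intCast_zmod_eq_zero_iff_dvd]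
        exact dvd_pow hqy (by omega)
      push_cast at h1
      rw [← sq]
      exact (sub_eq_zero.1 h1).symm
    exact h8
end

section
/- Let p ≥ 3 be a prime and let x, y be integers with x² − 2 = y^p and y ≠ −1. Then: (1) if y ≢ −1 (mod p), then x ≢ 1 (mod p) and x ≢ −1 (mod p); (2) if y ≡ −1 (mod p), then x ≡ 1 (mod p²) or x ≡ −1 (mod p²), and moreover the p-adic valuation of (x−1)(x+1) equals the p-adic valuation of y+1 plus 1. -/
theorem elementary2 (p : ℕ) (hp : p.Prime) (hp3 : 3 ≤ p)
    (x y : ℤ) (h : x ^ 2 - 2 = y ^ p) (hy : y ≠ -1) :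
    (¬ y ≡ -1 [ZMOD (p : ℤ)] → ¬ x ≡ 1 [ZMOD (p : ℤ)] ∧ ¬ x ≡ -1 [ZMOD (p : ℤ)]) ∧
    (y ≡ -1 [ZMOD (p : ℤ)] →
      (x ≡ 1 [ZMOD ((p : ℤ) ^ 2)] ∨ x ≡ -1 [ZMOD ((p : ℤ) ^ 2)]) ∧
      padicValInt p ((x - 1) * (x + 1)) = padicValInt p (y + 1) + 1) := by
  haveI : Fact p.Prime := ⟨hp⟩
  have hpp : Prime (p : ℤ) := Nat.prime_iff_prime_int.mp hp
  have hodd : Odd p := hp.odd_of_ne_two (by omega)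
  have hfac : (x - 1) * (x + 1) = y ^ p + 1 ^ p := by rw [← h, one_pow]; ring
  have hdiv : ∀ m a b : ℤ, a ≡ b [ZMOD m] ↔ m ∣ a - b := fun m a b =>
    Int.modEq_comm.trans Int.modEq_iff_dvd
  constructor
  · intro hny
    have key : ¬ (p : ℤ) ∣ (x - 1) * (x + 1) := by
      intro hd
      apply hny
      rw [hfac] at hd
      rw [hdiv, sub_neg_eq_add]
      have h1 := (ZMod.intCast_zmod_eq_zero_iff_dvd _ p).2 hd
      push_cast at h1
      rw [ZMod.pow_card, ZMod.pow_card] at h1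
      apply (ZMod.intCast_zmod_eq_zero_iff_dvd _ p).1
      push_cast
      exact h1
    rw [hdiv, hdiv, sub_neg_eq_add]
    exact ⟨fun hd => key (hd.mul_right _), fun hd => key (hd.mul_left _)⟩
  · intro hym
    rw [hdiv, sub_neg_eq_add] at hym
    have hpy : ¬ (p : ℤ) ∣ y := fun hd => hpp.not_dvd_one ((dvd_add_right hd).1 hym)
    have hem := Int.emultiplicity_pow_add_pow hp hodd hym hpy hodd
    have hy1 : y + 1 ≠ 0 := fun hh => hy (by omega)
    have hn0 : y ^ p + 1 ^ p ≠ 0 := by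
      intro hh
      apply hy
      rw [one_pow] at hh
      apply hodd.strictMono_pow.injective
      simp only [hodd.neg_one_pow]
      omega
    have hfin : ∀ z : ℤ, z ≠ 0 → emultiplicity (p : ℤ) z = (padicValInt p z : ℕ) := by
      intro z hz
      rw [padicValInt.of_ne_one_ne_zero hp.ne_one hz]
      apply FiniteMultiplicity.emultiplicity_eq_multiplicity
      exact Int.finiteMultiplicity_iff.2 ⟨by simpa using hp.ne_one, hz⟩
    have hval : padicValInt p ((x - 1) * (x + 1)) = padicValInt p (y + 1) + 1 := by
      have hself : emultiplicity p p = 1 := by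
        rw [← Int.natCast_emultiplicity, hfin _ (by exact_mod_cast hp.ne_zero),
          padicValInt.self hp.one_lt]
        rfl
      rw [hfin _ hn0, hfin _ hy1, hself] at hem
      rw [hfac]
      exact_mod_cast hem
    refine ⟨?_, hval⟩
    have h1 : 1 ≤ padicValInt p (y + 1) := by
      have := (padicValInt_dvd_iff (p := p) 1 (y + 1)).1 (by simpa using hym)
      tauto
    have h2 : (p : ℤ) ^ 2 ∣ (x - 1) * (x + 1) :=
      (padicValInt_dvd_iff 2 _).2 (Or.inr (by omega))
    rw [hdiv, hdiv, sub_neg_eq_add]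
    by_cases hx : (p : ℤ) ∣ x - 1
    · left
      have hx' : ¬ (p : ℤ) ∣ x + 1 := by
        intro hh
        have := dvd_sub hh hx
        have h3 := Int.le_of_dvd (by norm_num) (by simpa [show x + 1 - (x - 1) = 2 by ring] using this : (p : ℤ) ∣ 2)
        omega
      exact (IsCoprime.pow_left (hpp.coprime_iff_not_dvd.2 hx')).dvd_of_dvd_mul_right h2
    · right
      exact (IsCoprime.pow_left (hpp.coprime_iff_not_dvd.2 hx)).dvd_of_dvd_mul_left h2
end

section
/- Let p ≥ 3 be a prime and let x, y be integers with x² − 2 = y^p and y ≠ −1. If 3 divides x, then y ≡ 7 (mod 24); if 3 does not divide x, then y ≡ 23 (mod 24). Moreover, 3 divides y−1 if and only if 3 divides x. -/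
theorem pow_aux24 (y : ZMod 24) (j : ℕ) : y ^ (2 * j + 3) = y ^ 3 := by
  induction j with
  | zero => rfl
  | succ n ih =>
    have h5 : ∀ z : ZMod 24, z ^ 3 * z ^ 2 = z ^ 3 := by decide
    rw [show 2 * (n + 1) + 3 = (2 * n + 3) + 2 by ring, pow_add, ih, h5]

set_option maxRecDepth 100000 in
theorem cases_aux24 : ∀ x y : ZMod 24, x ^ 2 - 2 = y ^ 3 →
    (8 * x = 0 ∧ y = 7) ∨ (8 * x ≠ 0 ∧ y = 23) := by decide

theorem elementary3 (p : ℕ) (hp : p.Prime) (hp3 : 3 ≤ p)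
    (x y : ℤ) (h : x ^ 2 - 2 = y ^ p) (hy : y ≠ -1) :
    ((3 : ℤ) ∣ x → y ≡ 7 [ZMOD 24]) ∧
    (¬ (3 : ℤ) ∣ x → y ≡ 23 [ZMOD 24]) ∧
    ((3 : ℤ) ∣ (y - 1) ↔ (3 : ℤ) ∣ x) := by
  obtain ⟨j, rfl⟩ : ∃ j, p = 2 * j + 3 := by
    obtain ⟨k, hk⟩ := hp.odd_of_ne_two (by omega)
    exact ⟨k - 1, by omega⟩
  have h1 : (x : ZMod 24) ^ 2 - 2 = (y : ZMod 24) ^ 3 := by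
    rw [← pow_aux24 _ j]
    exact_mod_cast congrArg (Int.cast : ℤ → ZMod 24) h
  have hx : (8 * (x : ZMod 24) = 0) ↔ (3 : ℤ) ∣ x := by
    have := ZMod.intCast_zmod_eq_zero_iff_dvd (8 * x) 24
    push_cast at this
    rw [this]
    omega
  have key : ((3 : ℤ) ∣ x ∧ y ≡ 7 [ZMOD 24]) ∨ (¬ (3 : ℤ) ∣ x ∧ y ≡ 23 [ZMOD 24]) := by
    rcases cases_aux24 _ _ h1 with ⟨a, b⟩ | ⟨a, b⟩
    · exact Or.inl ⟨hx.1 a, (ZMod.intCast_eq_intCast_iff y 7 24).1 (by exact_mod_cast b)⟩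
    · exact Or.inr ⟨fun c => a (hx.2 c),
        (ZMod.intCast_eq_intCast_iff y 23 24).1 (by exact_mod_cast b)⟩
  unfold Int.ModEq at *
  omega
end

section
/- Let p ≥ 3 be a prime and let x, y be integers with x² − 2 = y^p and y ≠ −1. Then the 2-adic valuation of y−1 equals 1, the 3-adic valuation of y−1 equals 0 or 1, and every prime q different from 2 and 3 that divides y−1 satisfies q ≡ 1 (mod 12) or q ≡ 11 (mod 12). -/
lemma val_one_of (r : ℕ) (hr : r.Prime) (z : ℤ) (h1 : (r : ℤ) ∣ z) (h2 : ¬ (r : ℤ) ^ 2 ∣ z) :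
    padicValInt r z = 1 := by
  have := Fact.mk hr
  have hz : z ≠ 0 := by rintro rfl; simp at h2
  have a := (padicValInt_dvd_iff (p := r) 1 z).1 (by simpa using h1)
  have b := mt (padicValInt_dvd_iff (p := r) 2 z).2 h2
  push Not at b
  rcases a with a | a
  · exact absurd a hz
  · omega

lemma not_sq_two : ¬ IsSquare ((2 : ℕ) : ZMod 3) := by decide

lemma is_sq_one : IsSquare ((1 : ℕ) : ZMod 3) := by decide

lemma sq_three (q : ℕ) (hq : q.Prime) (h2 : q ≠ 2) (h3 : q ≠ 3)
    (hs : IsSquare ((3 : ℕ) : ZMod q)) : q ≡ 1 [MOD 12] ∨ q ≡ 11 [MOD 12] := by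
  have := Fact.mk hq
  have : Fact (Nat.Prime 3) := ⟨by norm_num⟩
  have hodd : q % 2 = 1 := hq.eq_two_or_odd.resolve_left h2
  have hn3 : q % 3 ≠ 0 := fun h =>
    h3 (((Nat.prime_dvd_prime_iff_eq (by norm_num) hq).1 (Nat.dvd_of_mod_eq_zero h)).symm)
  have hcast : ((q : ℕ) : ZMod 3) = ((q % 3 : ℕ) : ZMod 3) := by simp
  have n2 := not_sq_two
  have y1 := is_sq_one
  have h3' : q % 3 = 1 ∨ q % 3 = 2 := by omega
  unfold Nat.ModEq
  rcases (by omega : q % 4 = 1 ∨ q % 4 = 3) with h4 | h4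
  · have := (ZMod.exists_sq_eq_prime_iff_of_mod_four_eq_one (q := 3) h4 (by norm_num)).1 hs
    rw [hcast] at this
    rcases h3' with e | e <;> rw [e] at this
    · omega
    · exact absurd this n2
  · have := (ZMod.exists_sq_eq_prime_iff_of_mod_four_eq_three (q := 3) h4 (by norm_num) h3).1 hs
    rw [hcast] at this
    rcases h3' with e | e <;> rw [e] at this
    · exact absurd y1 this
    · omega

theorem elementary4 (p : ℕ) (hp : p.Prime) (hp3 : 3 ≤ p)
    (x y : ℤ) (h : x ^ 2 - 2 = y ^ p) (hy : y ≠ -1) :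
    padicValInt 2 (y - 1) = 1 ∧
    (padicValInt 3 (y - 1) = 0 ∨ padicValInt 3 (y - 1) = 1) ∧
    (∀ q : ℕ, q.Prime → q ≠ 2 → q ≠ 3 → (q : ℤ) ∣ (y - 1) →
      q ≡ 1 [MOD 12] ∨ q ≡ 11 [MOD 12]) := by
  have key : ∀ m : ℤ, m ∣ y - 1 → m ∣ x ^ 2 - 3 := by
    intro m hm
    have h1 : y - 1 ∣ y ^ p - 1 := sub_one_dvd_pow_sub_one y p
    rw [← h] at h1
    exact hm.trans (by rwa [show x ^ 2 - 3 = x ^ 2 - 2 - 1 by ring])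
  refine ⟨?_, ?_, ?_⟩
  · obtain ⟨k, hk⟩ := hp.odd_of_ne_two (by omega)
    have hz : ((x : ZMod 8)) ^ 2 - 2 = (y : ZMod 8) * ((y : ZMod 8) ^ 2) ^ k := by
      have := congrArg (Int.cast : ℤ → ZMod 8) h
      push_cast at this
      rw [this, hk]; ring
    have hk1 : k = (k - 1) + 1 := by omega
    have hy7 : (y : ZMod 8) = 7 := by
      generalize (x : ZMod 8) = a at hz
      generalize (y : ZMod 8) = b at hz
      have hb : b ^ 2 = 1 ∨ b * b ^ 2 = 0 := by
        clear hz; revert b; decide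
      rcases hb with hb | hb
      · rw [hb, one_pow, mul_one] at hz
        subst hz; revert hb; revert a; decide
      · rw [hk1, pow_succ' (b ^ 2), ← mul_assoc, hb, zero_mul] at hz
        exfalso; revert hz; revert a; decide
    have h8 : (8 : ℤ) ∣ y - 7 := by
      have := (ZMod.intCast_zmod_eq_zero_iff_dvd (y - 7) 8).1 (by push_cast; rw [hy7]; decide)
      exact_mod_cast this
    apply val_one_of 2 Nat.prime_two <;> norm_num <;> omega
  · by_cases h3 : (3 : ℤ) ∣ y - 1
    · right
      apply val_one_of 3 Nat.prime_three _ (by exact_mod_cast h3)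
      intro h9
      have := (ZMod.intCast_zmod_eq_zero_iff_dvd (x ^ 2 - 3) 9).2 (key _ (by exact_mod_cast h9))
      push_cast at this
      generalize (x : ZMod 9) = a at this
      revert a; decide
    · left
      exact padicValInt.eq_zero_of_not_dvd (by exact_mod_cast h3)
  · intro q hq h2 h3 hd
    have : NeZero q := ⟨hq.ne_zero⟩
    apply sq_three q hq h2 h3
    have := (ZMod.intCast_zmod_eq_zero_iff_dvd (x ^ 2 - 3) q).2 (key _ hd)
    push_cast at this
    refine ⟨(x : ZMod q), ?_⟩
    push_cast
    linear_combination -this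
end

section
/- Let p ≥ 3 be a prime and let x, y be integers with x² − 2 = y^p and y ≠ −1. Set S = ∑_{i=0}^{p−1} y^i (so that (y−1)·S = y^p − 1). Then: (1) every prime factor q of S satisfies q ≡ ±1 (mod 12); (2) every prime factor of S equals p or is ≡ 1 (mod p); moreover either p ∤ (y−1) and S ≡ 1 (mod p), or p ∣ (y−1), S ≡ p (mod p²) and p ≡ ±1 (mod 12); (3) S ≡ 1 (mod 24); (4) if p ≡ 2 (mod 3) or p = 3, then 3 does not divide x. -/
/-- A natural number all of whose prime factors are `±1` modulo 12 is itself `±1` modulo 12. -/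
lemma aux_mod12 (n : ℕ) (hn : n ≠ 0)
    (hq : ∀ q : ℕ, q.Prime → q ∣ n → q % 12 = 1 ∨ q % 12 = 11) : n % 12 = 1 ∨ n % 12 = 11 := by
  induction n using induction_on_primes with
  | zero => exact absurd rfl hn
  | one => left; rfl
  | prime_mul q m hqp ih =>
    have h1 := hq q hqp (dvd_mul_right q m)
    have h2 := ih (right_ne_zero_of_mul hn) (fun r hr hrm => hq r hr (hrm.mul_left q))
    rcases h1 with h1 | h1 <;> rcases h2 with h2 | h2 <;> simp [Nat.mul_mod, h1, h2]

/-- 2 is not a square modulo 3. -/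
lemma aux_two : ∀ r : ZMod 3, ((2 : ℕ) : ZMod 3) ≠ r * r := by decide

/-- If 3 is a square modulo a prime `q ≠ 2, 3`, then `q ≡ ±1` modulo 12. -/
lemma aux_three (q : ℕ) (hq : q.Prime) (h2 : q ≠ 2) (h3 : q ≠ 3) (x : ℤ)
    (hx : (q : ℤ) ∣ x ^ 2 - 3) : q % 12 = 1 ∨ q % 12 = 11 := by
  have : Fact q.Prime := ⟨hq⟩
  have : Fact (Nat.Prime 3) := ⟨Nat.prime_three⟩
  have hsq : IsSquare ((3 : ℕ) : ZMod q) := by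
    refine ⟨(x : ZMod q), ?_⟩
    have := (ZMod.intCast_zmod_eq_zero_iff_dvd _ q).2 hx
    push_cast at this ⊢
    linear_combination -this
  have hodd := hq.odd_of_ne_two h2
  have h3' : q % 3 ≠ 0 := fun hh =>
    h3 ((Nat.prime_dvd_prime_iff_eq Nat.prime_three hq).1 (Nat.dvd_of_mod_eq_zero hh)).symm
  have hqc : ((q : ℕ) : ZMod 3) = ((q % 3 : ℕ) : ZMod 3) := by simp
  have h12 : q % 4 = 1 ∨ q % 4 = 3 := by
    rcases hodd with ⟨k, hk⟩; omega
  rcases h12 with h4 | h4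
  · have h5 := (ZMod.exists_sq_eq_prime_iff_of_mod_four_eq_one h4 (by norm_num : 3 ≠ 2)).1 hsq
    have : q % 3 ≠ 2 := by
      intro h6
      rw [hqc, h6] at h5
      obtain ⟨r, hr⟩ := h5
      exact aux_two r hr
    omega
  · have h5 := (ZMod.exists_sq_eq_prime_iff_of_mod_four_eq_three h4 (by norm_num : 3 % 4 = 3) h3).1 hsq
    have : q % 3 ≠ 1 := by
      intro h6
      rw [hqc, h6] at h5
      exact h5 ⟨1, by simp⟩
    omega

theorem elementary5 (p : ℕ) (hp : p.Prime) (hp3 : 3 ≤ p)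
    (x y : ℤ) (h : x ^ 2 - 2 = y ^ p) (hy : y ≠ -1)
    (S : ℤ) (hS : S = ∑ i ∈ Finset.range p, y ^ i) :
    (∀ q : ℕ, q.Prime → (q : ℤ) ∣ S → q ≡ 1 [MOD 12] ∨ q ≡ 11 [MOD 12]) ∧
    (∀ q : ℕ, q.Prime → (q : ℤ) ∣ S → q = p ∨ q ≡ 1 [MOD p]) ∧
    ((¬ (p : ℤ) ∣ (y - 1) ∧ S ≡ 1 [ZMOD (p : ℤ)]) ∨
      ((p : ℤ) ∣ (y - 1) ∧ S ≡ (p : ℤ) [ZMOD ((p : ℤ) ^ 2)] ∧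
        (p ≡ 1 [MOD 12] ∨ p ≡ 11 [MOD 12]))) ∧
    S ≡ 1 [ZMOD 24] ∧
    ((p ≡ 2 [MOD 3] ∨ p = 3) → ¬ (3 : ℤ) ∣ x) := by
  have hodd : Odd p := hp.odd_of_ne_two (by omega)
  have hgeo : S * (y - 1) = y ^ p - 1 := by rw [hS]; exact geom_sum_mul y p
  have hpos : 0 < S := by rw [hS]; exact hodd.geom_sum_pos
  -- sums of powers of `±1` in a commutative ring
  have hcast : ∀ n : ℕ, ((S : ℤ) : ZMod n) = ∑ i ∈ Finset.range p, (y : ZMod n) ^ i := by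
    intro n; rw [hS]; push_cast; rfl
  have hone : ∀ n : ℕ, (y : ZMod n) = 1 → (S : ZMod n) = p := by
    intro n hn; rw [hcast, hn]; simp
  have hneg : ∀ n : ℕ, (y : ZMod n) = -1 → (S : ZMod n) = 1 := by
    intro n hn
    rw [hcast, hn, neg_one_geom_sum, if_neg (Nat.not_even_iff_odd.2 hodd)]
  obtain ⟨k, hk⟩ := hodd
  -- modulo 8
  have hy8 : (y : ZMod 8) = -1 := by
    have h8 : (x : ZMod 8) ^ 2 - 2 = (y : ZMod 8) ^ p := by
      have := congrArg (Int.cast : ℤ → ZMod 8) h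
      push_cast at this; exact this
    have key : ∀ a b : ZMod 8, (b ^ 2 = 1 → a ^ 2 - 2 = b → b = -1) ∧
        (b ^ 2 ≠ 1 → b ^ 3 = 0 ∧ a ^ 2 - 2 ≠ 0) := by decide
    obtain ⟨k1, k2⟩ := key x y
    by_cases hb : (y : ZMod 8) ^ 2 = 1
    · refine k1 hb ?_
      rw [h8, hk, pow_succ, pow_mul, hb]; simp
    · obtain ⟨k3, k4⟩ := k2 hb
      exact absurd (by rw [h8, ← Nat.add_sub_cancel' hp3, pow_add, k3, zero_mul]) k4
  have hS8 : S % 8 = 1 := by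
    have := hneg 8 hy8
    have h2 : ((S : ℤ) : ZMod 8) = ((1 : ℤ) : ZMod 8) := by simpa using this
    exact (ZMod.intCast_eq_intCast_iff _ _ 8).1 h2
  -- modulo 3
  have hy3 : ((y : ZMod 3) = -1 ∧ (x : ZMod 3) ≠ 0) ∨ ((y : ZMod 3) = 1 ∧ (x : ZMod 3) = 0) := by
    have h8 : (x : ZMod 3) ^ 2 - 2 = (y : ZMod 3) ^ p := by
      have := congrArg (Int.cast : ℤ → ZMod 3) h
      push_cast at this; exact this
    have e : (y : ZMod 3) ^ p = y := by
      have key : ∀ b : ZMod 3, b ≠ 0 → b ^ 2 = 1 := by decide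
      by_cases hb : (y : ZMod 3) = 0
      · rw [hb, zero_pow (by omega)]
      · rw [hk, pow_succ, pow_mul, key _ hb]; simp
    rw [e] at h8
    have key : ∀ a b : ZMod 3, a ^ 2 - 2 = b → (b = -1 ∧ a ≠ 0) ∨ (b = 1 ∧ a = 0) := by decide
    exact key _ _ h8
  have hp3x : p = 3 → (x : ZMod 3) ≠ 0 := by
    rintro rfl hx
    have hx' : (3 : ℤ) ∣ x := (ZMod.intCast_zmod_eq_zero_iff_dvd x 3).1 hx
    obtain ⟨t, rfl⟩ := hx'
    have h9 := congrArg (Int.cast : ℤ → ZMod 9) h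
    push_cast at h9
    have key : ∀ a b : ZMod 9, (3 * a) ^ 2 - 2 ≠ b ^ 3 := by decide
    exact key _ _ h9
  have hS3 : S % 3 ≠ 0 := by
    intro h0
    have h0' : (S : ZMod 3) = 0 :=
      (ZMod.intCast_zmod_eq_zero_iff_dvd S 3).2 (Int.dvd_of_emod_eq_zero h0)
    rcases hy3 with ⟨a, _⟩ | ⟨a, b⟩
    · rw [hneg 3 a] at h0'; revert h0'; decide
    · rw [hone 3 a, ZMod.natCast_eq_zero_iff] at h0'
      exact hp3x ((Nat.prime_dvd_prime_iff_eq Nat.prime_three hp).1 h0').symm b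
  -- part 1
  have P1 : ∀ q : ℕ, q.Prime → (q : ℤ) ∣ S → q % 12 = 1 ∨ q % 12 = 11 := by
    intro q hq hqS
    refine aux_three q hq ?_ ?_ x ?_
    · rintro rfl; omega
    · rintro rfl; omega
    · have : x ^ 2 - 3 = S * (y - 1) := by rw [hgeo, ← h]; ring
      rw [this]; exact hqS.mul_right _
  have hS12 : S % 12 = 1 := by
    lift S to ℕ using hpos.le
    have := aux_mod12 S (by omega) (fun q hq hd => P1 q hq (by exact_mod_cast hd))
    omega
  have P4 : (p ≡ 2 [MOD 3] ∨ p = 3) → ¬ (3 : ℤ) ∣ x := by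
    intro hh hx
    have hx' : (x : ZMod 3) = 0 := (ZMod.intCast_zmod_eq_zero_iff_dvd x 3).2 hx
    rcases hh with hh | hh
    · rcases hy3 with ⟨_, b⟩ | ⟨a, _⟩
      · exact b hx'
      · have h1 := hone 3 a
        have h2 : ((S : ℤ) : ZMod 3) = ((p : ℤ) : ZMod 3) := by simpa using h1
        have h3 : S % 3 = p % 3 := (ZMod.intCast_eq_intCast_iff _ _ 3).1 h2
        have h4 : p % 3 = 2 := hh
        omega
    · exact hp3x hh hx'
  have P2 : ∀ q : ℕ, q.Prime → (q : ℤ) ∣ S → q = p ∨ q ≡ 1 [MOD p] := by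
    intro q hq hqS
    have : Fact q.Prime := ⟨hq⟩
    have : Fact p.Prime := ⟨hp⟩
    have hS0 : (S : ZMod q) = 0 := (ZMod.intCast_zmod_eq_zero_iff_dvd S q).2 hqS
    have hyp : (y : ZMod q) ^ p = 1 := by
      have := congrArg (Int.cast : ℤ → ZMod q) hgeo
      push_cast at this
      rw [hS0, zero_mul] at this
      exact (sub_eq_zero.1 this.symm)
    by_cases hy1 : (y : ZMod q) = 1
    · left
      rw [hone q hy1, ZMod.natCast_eq_zero_iff] at hS0
      exact (Nat.prime_dvd_prime_iff_eq hq hp).1 hS0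
    · right
      have ho := orderOf_eq_prime hyp hy1
      have hy0 : (y : ZMod q) ≠ 0 := by
        intro h0; rw [h0, zero_pow (by omega)] at hyp; exact zero_ne_one hyp
      have hd := ZMod.orderOf_dvd_card_sub_one hy0
      rw [ho] at hd
      exact ((Nat.modEq_iff_dvd' hq.one_lt.le).2 hd).symm
  refine ⟨P1, P2, ?_, ?_, P4⟩
  · have : Fact p.Prime := ⟨hp⟩
    by_cases hd : (p : ℤ) ∣ y - 1
    · right
      obtain ⟨t, ht⟩ := hd
      have h1 : (p : ℤ) ^ 2 ∣ S - p := by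
        have := odd_sq_dvd_geom_sum₂_sub (a := (1 : ℤ)) (b := t) (p := p) ⟨k, hk⟩
        have e : 1 + (p : ℤ) * t = y := by linarith
        simpa [e, ← hS] using this
      refine ⟨⟨t, ht⟩, (Int.modEq_iff_dvd.2 h1).symm, P1 p hp ?_⟩
      have h2 : (p : ℤ) ∣ S - p := (Dvd.intro_left _ (by ring : (p : ℤ) * p = p ^ 2)).trans h1
      simpa using h2.add (dvd_refl (p : ℤ))
    · left
      refine ⟨hd, ?_⟩
      have hy1 : (y : ZMod p) - 1 ≠ 0 := by
        intro h0
        exact hd ((ZMod.intCast_zmod_eq_zero_iff_dvd _ p).1 (by push_cast; exact h0))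
      have := congrArg (Int.cast : ℤ → ZMod p) hgeo
      push_cast at this
      rw [ZMod.pow_card] at this
      have h2 := mul_right_cancel₀ hy1 (this.trans (one_mul _).symm)
      exact (ZMod.intCast_eq_intCast_iff _ _ p).1 (by simpa using h2)
  · show S % 24 = 1 % 24
    omega
end

section
/- Let p ≥ 3 be a prime and let x, y be integers with x² − 2 = y^p. Then there exist integers a, b, r with |r| ≤ (p−1)/2 such that, as real numbers, x + √2 = (1+√2)^r · (a + b√2)^p (where (1+√2)^r denotes the integer power, allowing negative exponents). Consequently a and b satisfy the Thue equation (1/(2√2))·((1+√2)^r (a+b√2)^p − (1−√2)^r (a−b√2)^p) = 1. -/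
namespace ThueRed

open Zsqrtd

lemma two_ne_sq (n : ℤ) : (2 : ℤ) ≠ n * n := by
  intro h
  have h1 : n < 2 := by nlinarith
  have h2 : -2 < n := by nlinarith
  interval_cases n <;> omega

noncomputable def phi : ℤ√2 →+* ℝ :=
  Zsqrtd.lift ⟨Real.sqrt 2, by simp⟩

noncomputable def psi : ℤ√2 →+* ℝ :=
  Zsqrtd.lift ⟨-Real.sqrt 2, by simp⟩

lemma phi_apply (z : ℤ√2) : phi z = z.re + z.im * Real.sqrt 2 := by
  simp [phi]

lemma psi_apply (z : ℤ√2) : psi z = z.re - z.im * Real.sqrt 2 := by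
  simp [psi]; ring

lemma phi_inj : Function.Injective phi := Zsqrtd.lift_injective _ two_ne_sq

lemma isDomain : IsDomain (ℤ√2) := phi_inj.isDomain phi

lemma norm_ne {z : ℤ√2} (h : z ≠ 0) : z.norm ≠ 0 := fun h' =>
  h ((Zsqrtd.norm_eq_zero two_ne_sq z).1 h')

lemma exists_near (A N : ℤ) (hN : N ≠ 0) : ∃ m : ℤ, 2 * |A - m * N| ≤ |N| := by
  have hpos : 0 < N.natAbs := Int.natAbs_pos.2 hN
  have h1 := Int.bmod_add_bdiv A N.natAbs
  have h2 := Int.le_bmod (x := A) hpos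
  have h3 := Int.bmod_le (x := A) hpos
  rw [← Int.abs_eq_natAbs] at *
  have key : 2 * |A - |N| * A.bdiv N.natAbs| ≤ |N| := by
    have : A - |N| * A.bdiv N.natAbs = A.bmod N.natAbs := by linarith
    rw [this]
    rcases abs_cases (A.bmod N.natAbs) with h | h <;> omega
  rcases abs_cases N with h | h
  · refine ⟨A.bdiv N.natAbs, ?_⟩
    rw [mul_comm (A.bdiv _)]
    nth_rewrite 1 [← h.1]
    exact key
  · refine ⟨-A.bdiv N.natAbs, ?_⟩
    have : A - -A.bdiv N.natAbs * N = A - |N| * A.bdiv N.natAbs := by rw [h.1]; ring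
    rw [this]
    exact key

lemma exists_quot (x y : ℤ√2) (hy : y ≠ 0) :
    ∃ q : ℤ√2, (x - y * q).norm.natAbs < y.norm.natAbs := by
  have hN := norm_ne hy
  obtain ⟨m, hm⟩ := exists_near (x * star y).re y.norm hN
  obtain ⟨n, hn⟩ := exists_near (x * star y).im y.norm hN
  refine ⟨⟨m, n⟩, ?_⟩
  have e : (x - y * ⟨m, n⟩).norm * y.norm =
      ((x * star y).re - m * y.norm) ^ 2 - 2 * ((x * star y).im - n * y.norm) ^ 2 := by
    simp [Zsqrtd.norm_def]
    ring
  zify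
  generalize (x * star y).re - m * y.norm = s at *
  generalize (x * star y).im - n * y.norm = t at *
  generalize y.norm = N at *
  have hp : 0 < |N| := abs_pos.2 hN
  have hs : 4 * s ^ 2 ≤ |N| ^ 2 := by
    rw [← sq_abs s]; nlinarith [abs_nonneg s]
  have ht : 4 * t ^ 2 ≤ |N| ^ 2 := by
    rw [← sq_abs t]; nlinarith [abs_nonneg t]
  have h2 : |(x - y * ⟨m, n⟩).norm| * |N| < |N| * |N| := by
    rw [← abs_mul, e, abs_lt]
    constructor <;> nlinarith [sq_nonneg s, sq_nonneg t]
  exact lt_of_mul_lt_mul_right h2 hp.le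

noncomputable def quo (x y : ℤ√2) : ℤ√2 :=
  open Classical in if hy : y = 0 then 0 else (exists_quot x y hy).choose

@[reducible] noncomputable def euclid : EuclideanDomain (ℤ√2) :=
  { (inferInstance : CommRing (ℤ√2)), (isDomain.toNontrivial : Nontrivial (ℤ√2)) with
    quotient := quo
    quotient_zero := fun a => by simp [quo]
    remainder := fun x y => x - y * quo x y
    quotient_mul_add_remainder_eq := fun a b => by ring
    r := _
    r_wellFounded := (measure (fun z : ℤ√2 => z.norm.natAbs)).wf
    remainder_lt := fun a b hb => by
      have := (exists_quot a b hb).choose_spec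
      simpa [quo, hb, WellFoundedRelation.rel, InvImage] using this
    mul_left_not_lt := fun a b hb => by
      have h1 : 1 ≤ b.norm.natAbs := Int.natAbs_pos.2 (norm_ne hb)
      have h2 : (a * b).norm.natAbs = a.norm.natAbs * b.norm.natAbs := by
        rw [Zsqrtd.norm_mul, Int.natAbs_mul]
      have h3 : a.norm.natAbs ≤ (a * b).norm.natAbs := by
        rw [h2]; exact Nat.le_mul_of_pos_right _ h1
      exact not_lt_of_ge h3 }

lemma isPID : IsPrincipalIdealRing (ℤ√2) :=
  @EuclideanDomain.to_principal_ideal_domain _ euclid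

def eps : (ℤ√2)ˣ := ⟨⟨1, 1⟩, ⟨-1, 1⟩, by ext <;> simp, by ext <;> simp⟩

def fund : Pell.Solution₁ 2 := Pell.Solution₁.mk 3 2 (by norm_num)

lemma fund_is : Pell.IsFundamental fund := by
  refine ⟨by simp [fund], by simp [fund], ?_⟩
  intro b hb
  simp only [fund, Pell.Solution₁.x_mk]
  by_contra h
  have hx : b.x = 2 := by omega
  have := b.prop
  rw [hx] at this
  omega

def tu : Pell.Solution₁ 2 →* (ℤ√2)ˣ := Unitary.toUnits (R := ℤ√2)

lemma toUnits_fund : tu fund = eps ^ 2 := by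
  ext <;> simp [tu, eps, sq, fund, Pell.Solution₁.mk] <;> rfl

lemma unit_one (u : (ℤ√2)ˣ) (hu : (u : ℤ√2).norm = 1) :
    ∃ n : ℤ, u = eps ^ n ∨ u = - eps ^ n := by
  let a : Pell.Solution₁ 2 := ⟨(u : ℤ√2), Zsqrtd.norm_eq_one_iff_mem_unitary.1 hu⟩
  have ha : tu a = u := by ext <;> rfl
  obtain ⟨n, hn⟩ := fund_is.eq_zpow_or_neg_zpow a
  have hz : tu (fund ^ n) = eps ^ (2 * n) := by
    rw [map_zpow, toUnits_fund, zpow_mul]; rfl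
  refine ⟨2 * n, ?_⟩
  rcases hn with hn | hn
  · left; rw [← ha, hn, hz]
  · right; rw [← ha, hn, ← hz]; ext <;> rfl

lemma unit_all (u : (ℤ√2)ˣ) : ∃ n : ℤ, u = eps ^ n ∨ u = - eps ^ n := by
  have h1 := Zsqrtd.norm_eq_one_iff.2 u.isUnit
  rcases Int.natAbs_eq_iff.1 h1 with h | h
  · exact unit_one u (by simpa using h)
  · have : ((u * eps : (ℤ√2)ˣ) : ℤ√2).norm = 1 := by
      rw [Units.val_mul, Zsqrtd.norm_mul, h]
      simp [eps, Zsqrtd.norm_def]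
    obtain ⟨n, hn⟩ := unit_one _ this
    refine ⟨n - 1, ?_⟩
    rcases hn with hn | hn
    · left; rw [zpow_sub_one, ← hn]; simp
    · right; rw [zpow_sub_one, ← neg_mul, ← hn]; simp

lemma coprime (x : ℤ) (hx : x % 2 = 1) : IsCoprime (⟨x, 1⟩ : ℤ√2) ⟨x, -1⟩ := by
  obtain ⟨k, rfl⟩ : ∃ k, x = 2 * k + 1 := ⟨x / 2, by omega⟩
  -- x ^ 2 - 2 = 4 * (k ^ 2 + k) - 1
  refine ⟨⟨0, k ^ 2 + k⟩ - ⟨2 * k + 1, -1⟩, -⟨0, k ^ 2 + k⟩, ?_⟩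
  ext <;> simp <;> ring

lemma odd_x (p : ℕ) (hp3 : 3 ≤ p) (x y : ℤ) (h : x ^ 2 - 2 = y ^ p) : x % 2 = 1 := by
  by_contra hx
  obtain ⟨k, rfl⟩ : ∃ k, x = 2 * k := ⟨x / 2, by omega⟩
  have h2 : (2 : ℤ) ∣ y ^ p := ⟨2 * k ^ 2 - 1, by rw [← h]; ring⟩
  have h3 : (2 : ℤ) ∣ y := Int.prime_two.dvd_of_dvd_pow h2
  have h4 : (2 : ℤ) ^ 2 ∣ y ^ p := (pow_dvd_pow_of_dvd h3 2).trans (pow_dvd_pow y (by omega))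
  obtain ⟨c, hc⟩ := h4
  rw [hc] at h
  ring_nf at h
  omega

lemma main (p : ℕ) (hp : p.Prime) (hp3 : 3 ≤ p) (x y : ℤ) (h : x ^ 2 - 2 = y ^ p) :
    ∃ (r : ℤ) (z : ℤ√2), |r| ≤ ((p : ℤ) - 1) / 2 ∧
      (⟨x, 1⟩ : ℤ√2) = ((eps ^ r : (ℤ√2)ˣ) : ℤ√2) * z ^ p := by
  have hodd : Odd p := hp.odd_of_ne_two (by omega)
  have := isDomain
  have := isPID
  have hm : (⟨x, 1⟩ : ℤ√2) * ⟨x, -1⟩ = ((y : ℤ) : ℤ√2) ^ p := by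
    rw [← Int.cast_pow, ← h, sq]
    ext <;> simp <;> ring
  obtain ⟨d, u, hu⟩ := exists_associated_pow_of_mul_eq_pow' (coprime x (odd_x p hp3 x y h)) hm
  obtain ⟨n, hn⟩ := unit_all u
  have hb := Int.bmod_add_bdiv n p
  have hz : eps ^ n = eps ^ (n.bmod p) * (eps ^ (n.bdiv p)) ^ p := by
    rw [← zpow_natCast, ← zpow_mul, ← zpow_add, mul_comm (n.bdiv p), hb]
  have habs : |n.bmod p| ≤ ((p : ℤ) - 1) / 2 := by
    have h2 := Int.le_bmod (x := n) (m := p) (by omega)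
    have h3 := Int.bmod_le (x := n) (m := p) (by omega)
    obtain ⟨j, hj⟩ := hodd
    rw [abs_le]; constructor <;> omega
  rcases hn with hn | hn
  · refine ⟨n.bmod p, d * ((eps ^ (n.bdiv p) : (ℤ√2)ˣ) : ℤ√2), habs, ?_⟩
    rw [← hu, hn, hz]; push_cast; ring
  · refine ⟨n.bmod p, -(d * ((eps ^ (n.bdiv p) : (ℤ√2)ˣ) : ℤ√2)), habs, ?_⟩
    rw [← hu, hn, hz, hodd.neg_pow]; push_cast; ring

lemma map_eps (f : ℤ√2 →+* ℝ) (r : ℤ) :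
    f ((eps ^ r : (ℤ√2)ˣ) : ℤ√2) = (f (eps : ℤ√2)) ^ r := by
  have := congrArg Units.val (map_zpow (Units.map (f : ℤ√2 →* ℝ)) eps r)
  rw [Units.val_zpow_eq_zpow_val] at this
  exact this

end ThueRed

theorem reduction_to_thue (p : ℕ) (hp : p.Prime) (hp3 : 3 ≤ p)
    (x y : ℤ) (h : x ^ 2 - 2 = y ^ p) :
    ∃ a b r : ℤ, |r| ≤ ((p : ℤ) - 1) / 2 ∧
      (x : ℝ) + Real.sqrt 2 =
        (1 + Real.sqrt 2) ^ r * ((a : ℝ) + (b : ℝ) * Real.sqrt 2) ^ p ∧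
      (1 / (2 * Real.sqrt 2)) *
        ((1 + Real.sqrt 2) ^ r * ((a : ℝ) + (b : ℝ) * Real.sqrt 2) ^ p -
         (1 - Real.sqrt 2) ^ r * ((a : ℝ) - (b : ℝ) * Real.sqrt 2) ^ p) = 1 := by
  obtain ⟨r, z, hr, hz⟩ := ThueRed.main p hp hp3 x y h
  have h1 := congrArg ThueRed.phi hz
  have h2 := congrArg ThueRed.psi hz
  rw [map_mul, map_pow, ThueRed.map_eps, ThueRed.phi_apply, ThueRed.phi_apply,
    ThueRed.phi_apply] at h1
  rw [map_mul, map_pow, ThueRed.map_eps, ThueRed.psi_apply, ThueRed.psi_apply,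
    ThueRed.psi_apply] at h2
  simp only [ThueRed.eps, Int.cast_one, one_mul] at h1 h2
  refine ⟨z.re, z.im, r, hr, h1, ?_⟩
  rw [← h1, ← h2]
  have : Real.sqrt 2 ≠ 0 := by positivity
  field_simp
  ring
end

section
/- Let p ≥ 3 be a prime, let x, y be integers with x² − 2 = y^p and y ≠ −1, and let a, b, r be integers such that, as real numbers, x + √2 = (1+√2)^r · (a + b√2)^p. Then y = (−1)^r · (a² − 2b²), a ≠ 0, b ≠ 0, and gcd(a, b) = 1. -/
def nfUnit : (ℤ√2)ˣ := ⟨⟨1, 1⟩, ⟨-1, 1⟩, by ext <;> simp, by ext <;> simp⟩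

theorem nf_nonsquare : ∀ n : ℤ, (2 : ℤ) ≠ n * n := by
  intro n hn
  have h1 : n < 2 := by nlinarith
  have h2 : -2 < n := by nlinarith
  interval_cases n <;> omega

theorem norm_form (p : ℕ) (hp : p.Prime) (hp3 : 3 ≤ p)
    (x y : ℤ) (h : x ^ 2 - 2 = y ^ p) (hy : y ≠ -1)
    (a b r : ℤ)
    (hfact : (x : ℝ) + Real.sqrt 2 =
      (1 + Real.sqrt 2) ^ r * ((a : ℝ) + (b : ℝ) * Real.sqrt 2) ^ p) :
    y = ((-1 : ℤˣ) ^ r : ℤˣ) * (a ^ 2 - 2 * b ^ 2) ∧ a ≠ 0 ∧ b ≠ 0 ∧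
      IsCoprime a b := by
  have hodd : Odd p := hp.odd_of_ne_two (by omega)
  have key : (⟨x, 1⟩ : ℤ√2) = ((nfUnit ^ r : (ℤ√2)ˣ) : ℤ√2) * ⟨a, b⟩ ^ p := by
    apply Zsqrtd.lift_injective (R := ℝ) ⟨Real.sqrt 2, by norm_num⟩ nf_nonsquare
    rw [map_mul, map_pow]
    have hu : ∀ f : ℤ√2 →+* ℝ, f ((nfUnit ^ r : (ℤ√2)ˣ) : ℤ√2) = (f nfUnit) ^ r := by
      intro f
      have := congrArg (Units.val) (map_zpow (Units.map (f : ℤ√2 →* ℝ)) nfUnit r)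
      rw [Units.val_zpow_eq_zpow_val] at this
      exact this
    rw [hu]
    simpa [nfUnit] using hfact
  have hN : Zsqrtd.norm ((nfUnit ^ r : (ℤ√2)ˣ) : ℤ√2) = ((-1 : ℤˣ) ^ r : ℤˣ) := by
    have h1 := congrArg (Units.val)
      (map_zpow (Units.map (Zsqrtd.normMonoidHom : ℤ√2 →* ℤ)) nfUnit r)
    have h2 : Units.map (Zsqrtd.normMonoidHom : ℤ√2 →* ℤ) nfUnit = -1 := by
      ext
      simp [nfUnit, Zsqrtd.normMonoidHom, Zsqrtd.norm]
    rw [h2] at h1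
    exact h1
  have hpow : ∀ e : ℤˣ, (e : ℤ) = (e : ℤ) ^ p := by
    intro e
    rcases Int.units_eq_one_or e with rfl | rfl
    · simp
    · simp [hodd.neg_one_pow]
  have hyv : y = ((-1 : ℤˣ) ^ r : ℤˣ) * (a ^ 2 - 2 * b ^ 2) := by
    apply hodd.strictMono_pow.injective
    have h1 := congrArg (Zsqrtd.normMonoidHom : ℤ√2 →* ℤ) key
    rw [map_mul, map_pow] at h1
    change Zsqrtd.norm _ = Zsqrtd.norm _ * (Zsqrtd.norm _) ^ p at h1
    rw [hN, Zsqrtd.norm_def, Zsqrtd.norm_def] at h1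
    simp only at h1
    show y ^ p = _ ^ p
    rw [mul_pow, ← hpow, ← h]
    linear_combination h1
  have hcop : IsCoprime a b := by
    rw [Int.isCoprime_iff_gcd_eq_one]
    have ha : ((Int.gcd a b : ℤ) : ℤ√2) ∣ ⟨a, b⟩ :=
      (Zsqrtd.intCast_dvd _ _).2 ⟨Int.gcd_dvd_left .., Int.gcd_dvd_right ..⟩
    have h2 : ((Int.gcd a b : ℤ) : ℤ√2) ∣ ⟨x, 1⟩ := by
      rw [key]
      exact Dvd.dvd.mul_left (dvd_pow ha (by omega)) _
    have h3 := ((Zsqrtd.intCast_dvd _ _).1 h2).2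
    simp only at h3
    have := Int.natCast_dvd_natCast.1 (by simpa using h3 : ((Int.gcd a b : ℕ) : ℤ) ∣ ((1:ℕ) : ℤ))
    exact Nat.dvd_one.1 this
  refine ⟨hyv, ?_, ?_, hcop⟩
  · rintro rfl
    have hb : b * b = 1 := by
      rcases Int.isUnit_iff.1 (isCoprime_zero_left.1 hcop) with rfl | rfl <;> norm_num
    have h2y : (2 : ℤ) ∣ y := ⟨-((-1 : ℤˣ) ^ r : ℤˣ), by
      rw [hyv]; linear_combination (-2 * (((-1 : ℤˣ) ^ r : ℤˣ) : ℤ)) * hb⟩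
    have h4 : (2 : ℤ) ^ 2 ∣ y ^ p := (pow_dvd_pow_of_dvd h2y 2).trans (pow_dvd_pow y (by omega))
    rw [← h] at h4
    obtain ⟨k, hk⟩ := h4
    rcases Int.even_or_odd' x with ⟨m, rfl | rfl⟩ <;> ring_nf at hk <;> omega
  · rintro rfl
    have ha : a * a = 1 := by
      rcases Int.isUnit_iff.1 (isCoprime_zero_right.1 hcop) with rfl | rfl <;> norm_num
    have h1 : y = 1 := by
      rcases Int.units_eq_one_or ((-1 : ℤˣ) ^ r) with h1 | h1
      · rw [h1] at hyv; push_cast at hyv; linarith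
      · rw [h1] at hyv; push_cast at hyv; exact absurd (by linarith) hy
    rw [h1, one_pow] at h
    have h1 : x < 2 := by nlinarith
    have h2 : -2 < x := by nlinarith
    interval_cases x <;> omega
end

section
/- Let p ≥ 3 be a prime, let x, y be integers with x² − 2 = y^p, y ≠ −1 and x > 0, and let a, b, r be integers with |r| ≤ (p−1)/2 such that, as real numbers, x + √2 = (1+√2)^r · (a + b√2)^p. Then: (1) a + b√2 > 0, and a − b√2 > 0 if r is even while a − b√2 < 0 if r is odd; (2) r ≠ 0; (3) if r < 0, then a > 0 and b > 0; (4) if r > 0 and r is even, then a > 0 and b < 0, while if r > 0 and r is odd, then a < 0 and b > 0. -/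
def ConjPair (u v : ℝ) : Prop :=
  ∃ A B : ℤ, u = A + B * Real.sqrt 2 ∧ v = A - B * Real.sqrt 2

theorem ConjPair.mul {u v s t : ℝ} (h : ConjPair u v) (hst : ConjPair s t) :
    ConjPair (u * s) (v * t) := by
  obtain ⟨A, B, rfl, rfl⟩ := h
  obtain ⟨C, D, rfl, rfl⟩ := hst
  have hs : Real.sqrt 2 * Real.sqrt 2 = 2 := Real.mul_self_sqrt (by norm_num)
  refine ⟨A * C + 2 * B * D, A * D + B * C, ?_, ?_⟩ <;> push_cast <;>
    linear_combination (B * D : ℝ) * hs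

theorem ConjPair.pow {u v : ℝ} (h : ConjPair u v) (n : ℕ) : ConjPair (u ^ n) (v ^ n) := by
  induction n with
  | zero => exact ⟨1, 0, by simp, by simp⟩
  | succ n ih => rw [pow_succ, pow_succ]; exact ih.mul h

theorem conjPair_eps (r : ℤ) :
    ConjPair ((1 + Real.sqrt 2) ^ r) ((1 - Real.sqrt 2) ^ r) := by
  have hs : Real.sqrt 2 * Real.sqrt 2 = 2 := Real.mul_self_sqrt (by norm_num)
  have i1 : (1 + Real.sqrt 2)⁻¹ = -1 + Real.sqrt 2 :=
    inv_eq_of_mul_eq_one_right (by linear_combination hs)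
  have i2 : (1 - Real.sqrt 2)⁻¹ = -1 - Real.sqrt 2 :=
    inv_eq_of_mul_eq_one_right (by linear_combination hs)
  obtain ⟨n, rfl | rfl⟩ := r.eq_nat_or_neg
  · simp only [zpow_natCast]
    exact ConjPair.pow ⟨1, 1, by simp, by simp⟩ n
  · simp only [zpow_neg, zpow_natCast, ← inv_pow, i1, i2]
    exact ConjPair.pow ⟨-1, 1, by simp, by simp⟩ n

theorem conj_unique {x A B : ℤ} (h : (x : ℝ) + Real.sqrt 2 = A + B * Real.sqrt 2) :
    (x : ℝ) - Real.sqrt 2 = A - B * Real.sqrt 2 := by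
  have hB : B = 1 := by
    by_contra hB
    have hBne : ((B : ℝ) - 1) ≠ 0 := by
      intro h0; apply hB; exact_mod_cast (sub_eq_zero.mp h0)
    apply irrational_sqrt_two
    refine ⟨((x - A : ℤ) : ℚ) / ((B - 1 : ℤ) : ℚ), ?_⟩
    push_cast
    rw [div_eq_iff hBne]
    linear_combination h
  subst hB
  push_cast at *
  linarith

theorem sign_conditions (p : ℕ) (hp : p.Prime) (hp3 : 3 ≤ p)
    (x y : ℤ) (h : x ^ 2 - 2 = y ^ p) (hy : y ≠ -1) (hx : 0 < x)
    (a b r : ℤ) (hr : |r| ≤ ((p : ℤ) - 1) / 2)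
    (hfact : (x : ℝ) + Real.sqrt 2 =
      (1 + Real.sqrt 2) ^ r * ((a : ℝ) + (b : ℝ) * Real.sqrt 2) ^ p) :
    (0 < (a : ℝ) + (b : ℝ) * Real.sqrt 2 ∧
      (Even r → 0 < (a : ℝ) - (b : ℝ) * Real.sqrt 2) ∧
      (Odd r → (a : ℝ) - (b : ℝ) * Real.sqrt 2 < 0)) ∧
    r ≠ 0 ∧
    (r < 0 → 0 < a ∧ 0 < b) ∧
    (0 < r → (Even r → 0 < a ∧ b < 0) ∧ (Odd r → a < 0 ∧ 0 < b)) := by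
  have hodd : Odd p := hp.odd_of_ne_two (by omega)
  have hp0 : p ≠ 0 := by omega
  have hs : Real.sqrt 2 * Real.sqrt 2 = 2 := Real.mul_self_sqrt (by norm_num)
  have hs0 : 0 < Real.sqrt 2 := by positivity
  have hs1 : 1.4 < Real.sqrt 2 := by nlinarith
  have hs2 : Real.sqrt 2 < 1.5 := by nlinarith
  -- x ≥ 3
  have hx3 : 3 ≤ x := by
    by_contra hlt
    have : x = 1 ∨ x = 2 := by omega
    rcases this with rfl | rfl
    · apply hy
      have h1 : y ^ p = (-1) ^ p := by rw [hodd.neg_one_pow]; linarith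
      exact hodd.strictMono_pow.injective h1
    · have h2 : y ^ p = 2 := by linarith
      have hd : (2 : ℤ) ∣ y := Int.prime_two.dvd_of_dvd_pow (Dvd.intro 1 (by rw [h2]; norm_num) : (2 : ℤ) ∣ y ^ p)
      have h4 : (2 : ℤ) ^ 2 ∣ y ^ p := (pow_dvd_pow 2 (by omega)).trans (pow_dvd_pow_of_dvd hd p)
      rw [h2] at h4
      norm_num at h4
  have hx3R : (3 : ℝ) ≤ x := by exact_mod_cast hx3
  -- conjugate equation
  have hconj : (x : ℝ) - Real.sqrt 2 =
      (1 - Real.sqrt 2) ^ r * ((a : ℝ) - (b : ℝ) * Real.sqrt 2) ^ p := by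
    obtain ⟨A, B, h1, h2⟩ := (conjPair_eps r).mul
      (ConjPair.pow (u := (a : ℝ) + (b : ℝ) * Real.sqrt 2)
        (v := (a : ℝ) - (b : ℝ) * Real.sqrt 2) ⟨a, b, rfl, rfl⟩ p)
    rw [h2]
    rw [h1] at hfact
    exact conj_unique hfact
  have hE : 0 < (1 + Real.sqrt 2) ^ r := by positivity
  have hEE : (1 + Real.sqrt 2) ^ r * (1 - Real.sqrt 2) ^ r = (-1) ^ r := by
    rw [← mul_zpow]; congr 1; linear_combination -hs
  have hneg : r < 0 → (1 + Real.sqrt 2) ^ r < 1 := fun hr0 =>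
    zpow_lt_one_of_neg₀ (by linarith) hr0
  have hpos : 0 < r → 1 + Real.sqrt 2 ≤ (1 + Real.sqrt 2) ^ r := fun hr0 => by
    have := zpow_le_zpow_right₀ (a := 1 + Real.sqrt 2) (by linarith) (show (1 : ℤ) ≤ r by omega)
    simpa using this
  have hzero : r = 0 → (1 + Real.sqrt 2) ^ r = 1 := fun hr0 => by simp [hr0]
  set E := (1 + Real.sqrt 2) ^ r with hEdef
  set α := (a : ℝ) + (b : ℝ) * Real.sqrt 2 with hα
  set β := (a : ℝ) - (b : ℝ) * Real.sqrt 2 with hβ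
  have hαp : 0 < α ^ p := by
    by_contra hc
    nlinarith [mul_nonneg hE.le (neg_nonneg.mpr (not_lt.mp hc))]
  have hα0 : 0 < α := hodd.pow_pos_iff.mp hαp
  have hev : Even r → β ^ p = E * (x - Real.sqrt 2) := fun he => by
    rw [he.neg_one_zpow] at hEE
    rw [hconj, ← mul_assoc, hEE, one_mul]
  have hod : Odd r → (-β) ^ p = E * (x - Real.sqrt 2) := fun he => by
    rw [he.neg_one_zpow] at hEE
    rw [hconj, ← mul_assoc, hEE, hodd.neg_pow]; ring
  have key0 : ∀ γ : ℝ, γ ^ p = E * (x - Real.sqrt 2) → 0 < γ := fun γ hγ => by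
    apply hodd.pow_pos_iff.mp
    rw [hγ]; exact mul_pos hE (by linarith)
  have keyneg : r < 0 → ∀ γ : ℝ, γ ^ p = E * (x - Real.sqrt 2) → γ < α := fun hr0 γ hγ => by
    apply lt_of_pow_lt_pow_left₀ p hα0.le
    rw [hγ]
    have := hneg hr0
    nlinarith
  have keypos : 0 < r → ∀ γ : ℝ, γ ^ p = E * (x - Real.sqrt 2) → α < γ := fun hr0 γ hγ => by
    apply lt_of_pow_lt_pow_left₀ p (key0 γ hγ).le
    apply lt_of_mul_lt_mul_left _ hE.le
    rw [← hfact, hγ]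
    have h1 := hpos hr0
    have h2 : (1 + Real.sqrt 2) * (1 + Real.sqrt 2) ≤ E * E := by gcongr
    have h3 : (1 + Real.sqrt 2) * (1 + Real.sqrt 2) * (x - Real.sqrt 2)
        ≤ E * E * (x - Real.sqrt 2) := mul_le_mul_of_nonneg_right h2 (by linarith)
    nlinarith
  have castpos : ∀ n : ℤ, (0 : ℝ) < n → 0 < n := fun n hn => by exact_mod_cast hn
  have castneg : ∀ n : ℤ, (n : ℝ) < 0 → n < 0 := fun n hn => by exact_mod_cast hn
  have bpos : 0 < (b : ℝ) * Real.sqrt 2 → 0 < b := fun hb =>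
    castpos b (pos_of_mul_pos_left hb hs0.le)
  have bneg : (b : ℝ) * Real.sqrt 2 < 0 → b < 0 := fun hb =>
    castneg b (by by_contra hc; nlinarith [mul_nonneg (not_lt.mp hc) hs0.le])
  refine ⟨⟨hα0, fun he => key0 _ (hev he), fun ho => ?_⟩, ?_, ?_, ?_⟩
  · have := key0 _ (hod ho); linarith
  · intro hr0
    have he : Even r := by simp [hr0]
    have h1 := hev he
    have hβ0 := key0 _ h1
    rw [hzero hr0, one_mul] at h1 hfact
    have hlt : β < α := by
      apply lt_of_pow_lt_pow_left₀ p hα0.le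
      linarith
    have hb : 0 < b := bpos (by linarith)
    have hb1 : (1 : ℝ) ≤ b := by exact_mod_cast hb
    have h2 : β + 2 * Real.sqrt 2 ≤ α := by nlinarith
    have h3 : (β + 2 * Real.sqrt 2) ^ p ≤ α ^ p := by gcongr
    have h4 : β ^ p + (2 * Real.sqrt 2) ^ p ≤ (β + 2 * Real.sqrt 2) ^ p :=
      pow_add_pow_le hβ0.le (by positivity) hp0
    have h5 : 2 * Real.sqrt 2 < (2 * Real.sqrt 2) ^ p :=
      lt_self_pow₀ (by linarith) (by omega)
    linarith
  · intro hr0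
    rcases Int.even_or_odd r with he | ho
    · have h1 := keyneg hr0 _ (hev he)
      have h2 := key0 _ (hev he)
      exact ⟨castpos a (by linarith), bpos (by linarith)⟩
    · have h1 := keyneg hr0 _ (hod ho)
      have h2 := key0 _ (hod ho)
      exact ⟨castpos a (by linarith), bpos (by linarith)⟩
  · intro hr0
    refine ⟨fun he => ?_, fun ho => ?_⟩
    · have h1 := keypos hr0 _ (hev he)
      have h2 := key0 _ (hev he)
      exact ⟨castpos a (by linarith), bneg (by linarith)⟩
    · have h1 := keypos hr0 _ (hod ho)
      have h2 := key0 _ (hod ho)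
      exact ⟨castneg a (by linarith), bpos (by linarith)⟩
end

section
/- Let p ≥ 3 be a prime, let x, y be integers with x² − 2 = y^p, y ≠ −1 and x > 0, and let a, b, r be integers with r ≠ 0 and |r| ≤ (p−1)/2 such that, as real numbers, x + √2 = (1+√2)^r · (a + b√2)^p. Set ε = −1 if r > 0 and ε = 1 if r < 0, and define the real numbers α₁ = (a + εb√2)²/y and α₂ = 1 + √2. Then α₁ and α₂ are multiplicatively independent: for all integers m, n, if α₁^m · α₂^n = 1 then m = 0 and n = 0. -/
def uu : (ℤ√2)ˣ := ⟨⟨1, 1⟩, ⟨-1, 1⟩, by decide, by decide⟩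

noncomputable def ff : ℤ√2 →+* ℝ := Zsqrtd.toReal (d := 2) (by norm_num)

lemma ff_apply (a b : ℤ) : ff ⟨a, b⟩ = a + b * Real.sqrt 2 := by
  simp [ff]

lemma ff_inj : Function.Injective ff := by
  apply Zsqrtd.lift_injective
  intro n hn
  have h1 : n.natAbs * n.natAbs = 2 := by zify; rw [abs_mul_abs_self]; exact hn.symm
  rcases Nat.lt_or_ge n.natAbs 2 with h | h
  · interval_cases n.natAbs <;> omega
  · nlinarith

lemma ff_unit (r : ℤ) : ff ((uu ^ r : (ℤ√2)ˣ) : ℤ√2) = (1 + Real.sqrt 2) ^ r := by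
  have h : ((Units.map (ff : ℤ√2 →* ℝ) (uu ^ r) : ℝˣ) : ℝ) = (1 + Real.sqrt 2) ^ r := by
    rw [map_zpow, Units.val_zpow_eq_zpow_val]
    congr 1
    have := ff_apply 1 1
    simpa [uu] using this
  exact h

lemma core (q : ℤ) (hq : Prime q) (h2 : ¬ q ∣ 2) (c d : ℤ)
    (hB : (⟨c, d⟩ : ℤ√2) ∈ (Ideal.span {(q : ℤ√2)}).radical) : q ∣ c ∧ q ∣ d := by
  have key : ∀ z : ℤ, (z : ℤ√2) ∈ (Ideal.span {(q : ℤ√2)}).radical → q ∣ z := by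
    rintro z ⟨n, hn⟩
    rw [Ideal.mem_span_singleton, ← Int.cast_pow, Zsqrtd.intCast_dvd_intCast] at hn
    exact hq.dvd_of_dvd_pow hn
  have hS : (⟨c, -d⟩ : ℤ√2) ∈ (Ideal.span {(q : ℤ√2)}).radical := by
    obtain ⟨n, hn⟩ := hB
    refine ⟨n, ?_⟩
    rw [Ideal.mem_span_singleton] at hn ⊢
    have := map_dvd (starRingEnd (ℤ√2)) hn
    rw [map_pow] at this
    simpa [starRingEnd_apply, Zsqrtd.star_mk] using this
  have hc := key (2 * c) (by
    have := add_mem hB hS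
    convert this using 1
    ext <;> simp
    ring)
  have hd := key (2 * (2 * d)) (by
    have := Ideal.mul_mem_left _ (Zsqrtd.sqrtd) (sub_mem hB hS)
    convert this using 1
    ext <;> simp
    ring)
  refine ⟨(hq.dvd_or_dvd hc).resolve_left h2, ?_⟩
  exact (hq.dvd_or_dvd ((hq.dvd_or_dvd hd).resolve_left h2)).resolve_left h2

theorem mult_independent (p : ℕ) (hp : p.Prime) (hp3 : 3 ≤ p)
    (x y : ℤ) (h : x ^ 2 - 2 = y ^ p) (hy : y ≠ -1) (hx : 0 < x)
    (a b r : ℤ) (hr0 : r ≠ 0) (hr : |r| ≤ ((p : ℤ) - 1) / 2)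
    (hfact : (x : ℝ) + Real.sqrt 2 =
      (1 + Real.sqrt 2) ^ r * ((a : ℝ) + (b : ℝ) * Real.sqrt 2) ^ p)
    (ε : ℤ) (hε : ε = if 0 < r then -1 else 1)
    (α₁ α₂ : ℝ)
    (hα₁ : α₁ = ((a : ℝ) + (ε : ℝ) * (b : ℝ) * Real.sqrt 2) ^ 2 / (y : ℝ))
    (hα₂ : α₂ = 1 + Real.sqrt 2) :
    ∀ m n : ℤ, α₁ ^ m * α₂ ^ n = 1 → m = 0 ∧ n = 0 := by
  have hyq : ∃ q : ℤ, Prime q ∧ q ∣ y ∧ ¬ q ∣ 2 := by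
    have hn1 : y.natAbs ≠ 1 := by
      intro h1
      rcases Int.natAbs_eq y with h2 | h2
      · rw [h1] at h2
        rw [h2] at h
        simp at h
        have : x < 2 := by nlinarith
        have : x = 1 := by omega
        subst this
        norm_num at h
      · rw [h1] at h2
        exact hy (by simpa using h2)
    obtain ⟨q, hq, hqy⟩ := Nat.exists_prime_and_dvd hn1
    have hqy' : (q : ℤ) ∣ y := Int.natCast_dvd.mpr hqy
    refine ⟨q, Nat.prime_iff_prime_int.mp hq, hqy', ?_⟩
    intro hq2
    have hq2' : q = 2 := (Nat.prime_dvd_prime_iff_eq hq Nat.prime_two).mp (by exact_mod_cast hq2)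
    subst hq2'
    have h4 : (4 : ℤ) ∣ y ^ p := by
      have h1 : ((2 : ℤ)) ^ 2 ∣ y ^ 2 := pow_dvd_pow_of_dvd (by simpa using hqy') 2
      exact (by norm_num at h1; exact h1 : (4 : ℤ) ∣ y ^ 2).trans (pow_dvd_pow y (by omega))
    rw [← h] at h4
    rcases Int.even_or_odd' x with ⟨k, hk | hk⟩
    · rw [hk] at h4
      ring_nf at h4
      omega
    · rw [hk] at h4
      ring_nf at h4
      omega
  obtain ⟨q, hq, hqy, hq2⟩ := hyq
  have hy0 : (y : ℝ) ≠ 0 := by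
    intro h0
    have h0' : y = 0 := by exact_mod_cast h0
    rw [h0', zero_pow (by omega)] at h
    have : x < 2 := by nlinarith
    have : x = 1 := by omega
    subst this
    norm_num at h
  have hu1 : 1 < 1 + Real.sqrt 2 := by
    have : 0 < Real.sqrt 2 := by positivity
    linarith
  have hε' : ε = 1 ∨ ε = -1 := by
    rw [hε]; split_ifs <;> simp
  have hfz : (⟨x, 1⟩ : ℤ√2) = ((uu ^ r : (ℤ√2)ˣ) : ℤ√2) * ⟨a, b⟩ ^ p := by
    apply ff_inj
    rw [map_mul, map_pow, ff_unit, ff_apply, ff_apply, ← hfact]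
    simp
  have main : ∀ k : ℕ, k ≠ 0 → ∀ n : ℤ, α₁ ^ k * α₂ ^ n = 1 → False := by
    intro k hk n hkn
    have h1 : (⟨a, ε * b⟩ : ℤ√2) ^ (2 * k) * ((uu ^ n : (ℤ√2)ˣ) : ℤ√2) = (y : ℤ√2) ^ k := by
      apply ff_inj
      rw [map_mul, map_pow, ff_unit, ff_apply, map_pow, map_intCast]
      rw [hα₁, hα₂, div_pow, ← pow_mul, div_mul_eq_mul_div, div_eq_one_iff_eq (pow_ne_zero _ hy0)] at hkn
      rw [← hkn]
      push_cast
      ring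
    have h2 : (⟨a, ε * b⟩ : ℤ√2) ∈ (Ideal.span {(q : ℤ√2)}).radical := by
      refine ⟨2 * k, ?_⟩
      rw [Ideal.mem_span_singleton]
      have h3 : (q : ℤ√2) ∣ (y : ℤ√2) ^ k :=
        ((Zsqrtd.intCast_dvd_intCast _ _).mpr hqy).trans (dvd_pow_self _ hk)
      rw [← h1] at h3
      exact (Units.dvd_mul_right).mp h3
    obtain ⟨ha, hb⟩ := core q hq hq2 _ _ h2
    have hb' : q ∣ b := by
      rcases hε' with h | h <;> rw [h] at hb <;> simpa using hb
    have h4 : (q : ℤ√2) ∣ ⟨a, b⟩ := (Zsqrtd.intCast_dvd _ _).mpr ⟨ha, hb'⟩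
    have h5 : (q : ℤ√2) ∣ ⟨x, 1⟩ := by
      rw [hfz]
      exact Dvd.dvd.mul_left (h4.trans (dvd_pow_self _ (by omega))) _
    have h6 := ((Zsqrtd.intCast_dvd _ _).mp h5).2
    exact hq.not_isUnit (isUnit_of_dvd_one h6)
  intro m n hmn
  have hm : m = 0 := by
    by_contra hm
    obtain ⟨k, hk | hk⟩ := Int.eq_nat_or_neg m
    · subst hk
      exact main k (by simpa using hm) n (by simpa using hmn)
    · subst hk
      refine main k (by simpa using hm) (-n) ?_
      have := congrArg (·⁻¹) hmn
      simpa [mul_inv, mul_comm] using this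
  refine ⟨hm, ?_⟩
  subst hm
  rw [zpow_zero, one_mul, hα₂] at hmn
  exact (zpow_eq_one_iff_right₀ (by linarith) hu1.ne').mp hmn
end

section
/- Let p ≥ 3 be a prime and let x, y be integers with x² − 2 = y^p, y ≠ −1 and x > 0. Define Λ = log((x + √2)/(x − √2)), where log is the natural logarithm on the reals. Then log Λ < 1.053 − (log y)·p/2. -/
theorem upper_bound_linear_form (p : ℕ) (hp : p.Prime) (hp3 : 3 ≤ p)
    (x y : ℤ) (h : x ^ 2 - 2 = y ^ p) (hy : y ≠ -1) (hx : 0 < x)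
    (Λ : ℝ) (hΛ : Λ = Real.log (((x : ℝ) + Real.sqrt 2) / ((x : ℝ) - Real.sqrt 2))) :
    Real.log Λ < 1.053 - Real.log (y : ℝ) * (p : ℝ) / 2 := by
  have hodd : Odd p := hp.odd_of_ne_two (by omega)
  have hx2 : 2 ≤ x := by
    by_contra hlt
    have hx1 : x = 1 := by omega
    subst hx1
    apply hy
    have h1 : y ^ p = (-1) ^ p := by rw [← h, hodd.neg_one_pow]; norm_num
    exact hodd.strictMono_pow.injective h1
  have hxr : (2 : ℝ) ≤ x := by exact_mod_cast hx2
  have hN : (x : ℝ) ^ 2 - 2 = (y : ℝ) ^ p := by exact_mod_cast h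
  have hs : Real.sqrt 2 ^ 2 = 2 := Real.sq_sqrt (by norm_num)
  have hs0 : 0 < Real.sqrt 2 := by positivity
  have hs2 : Real.sqrt 2 < 2 := by nlinarith
  set s := Real.sqrt 2
  have hb : 0 < (x : ℝ) - s := by linarith
  have ha : 0 < (x : ℝ) + s := by linarith
  have hNpos : 0 < (x : ℝ) ^ 2 - 2 := by nlinarith
  have hΛ0 : 0 < Λ := by
    rw [hΛ]
    apply Real.log_pos
    rw [lt_div_iff₀ hb]
    linarith
  have hc : Real.cosh Λ = 1 + 4 / ((x : ℝ) ^ 2 - 2) := by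
    rw [hΛ, Real.cosh_log (by positivity)]
    have e : (x : ℝ) ^ 2 - 2 = (x + s) * (x - s) := by rw [← hs]; ring
    rw [e]
    field_simp
    linear_combination 4 * hs
  have hsinh : Λ / 2 ≤ Real.sinh (Λ / 2) := Real.self_le_sinh_iff.2 (by linarith)
  have hc2 : Real.cosh Λ = 1 + 2 * Real.sinh (Λ / 2) ^ 2 := by
    have h1 := Real.cosh_two_mul (Λ / 2)
    have h2 := Real.cosh_sq (Λ / 2)
    rw [show 2 * (Λ / 2) = Λ by ring] at h1
    linarith
  have hsq : Λ ^ 2 ≤ 2 ^ 3 / ((x : ℝ) ^ 2 - 2) := by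
    have h1 : (Λ / 2) ^ 2 ≤ Real.sinh (Λ / 2) ^ 2 := by gcongr
    have h2 : (2 : ℝ) ^ 3 / ((x : ℝ) ^ 2 - 2) = 2 * (4 / ((x : ℝ) ^ 2 - 2)) := by ring
    rw [h2]
    linarith
  have hl := Real.log_le_log (by positivity) hsq
  rw [Real.log_div (by norm_num) hNpos.ne', hN, Real.log_pow, Real.log_pow, Real.log_pow] at hl
  have := Real.log_two_lt_d9
  push_cast at hl
  norm_num at this ⊢
  linarith
end

section
/- Let p be an odd prime and let r be an integer not divisible by p. Then (1+√2)^r is not a p-th power in ℚ(√2): there do not exist rational numbers a, b such that, as real numbers, (a + b√2)^p = (1+√2)^r (where (1+√2)^r denotes the integer power, allowing negative r). -/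
lemma rat_sqrt_two_indep (x y : ℚ) (h : (x : ℝ) + y * Real.sqrt 2 = 0) : x = 0 ∧ y = 0 := by
  have hy : y = 0 := by
    by_contra hy
    apply irrational_sqrt_two
    refine ⟨-x / y, ?_⟩
    have hy' : (y : ℝ) ≠ 0 := by exact_mod_cast hy
    push_cast
    field_simp
    linarith
  subst hy
  refine ⟨?_, rfl⟩
  simpa using h

/-- The field ℚ(√2) as a predicate on the reals. -/
def InQ (z : ℝ) : Prop := ∃ a b : ℚ, z = (a : ℝ) + b * Real.sqrt 2

lemma InQ.mul {z w : ℝ} (hz : InQ z) (hw : InQ w) : InQ (z * w) := by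
  obtain ⟨a, b, rfl⟩ := hz
  obtain ⟨c, d, rfl⟩ := hw
  refine ⟨a * c + 2 * b * d, a * d + b * c, ?_⟩
  have hs : Real.sqrt 2 * Real.sqrt 2 = 2 := Real.mul_self_sqrt (by norm_num)
  push_cast
  linear_combination (b : ℝ) * d * hs

lemma InQ.one : InQ 1 := ⟨1, 0, by simp⟩

lemma InQ.inv {z : ℝ} (hz : InQ z) : InQ z⁻¹ := by
  by_cases h0 : z = 0
  · subst h0; exact ⟨0, 0, by simp⟩
  obtain ⟨a, b, rfl⟩ := hz
  have hs : Real.sqrt 2 * Real.sqrt 2 = 2 := Real.mul_self_sqrt (by norm_num)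
  have hc : (a : ℝ) - b * Real.sqrt 2 ≠ 0 := by
    intro h
    obtain ⟨h1, h2⟩ := rat_sqrt_two_indep a (-b) (by push_cast; linarith)
    have h2 : b = 0 := by linarith
    subst h1 h2
    simp at h0
  have hN : (a : ℝ) ^ 2 - 2 * b ^ 2 ≠ 0 := by
    have : (a : ℝ) ^ 2 - 2 * b ^ 2 = (a + b * Real.sqrt 2) * (a - b * Real.sqrt 2) := by
      linear_combination (b : ℝ) ^ 2 * hs
    rw [this]
    exact mul_ne_zero h0 hc
  refine ⟨a / (a ^ 2 - 2 * b ^ 2), -b / (a ^ 2 - 2 * b ^ 2), ?_⟩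
  symm
  apply eq_inv_of_mul_eq_one_left
  push_cast
  field_simp
  linear_combination (-(b : ℝ) ^ 2) * hs

lemma InQ.pow {z : ℝ} (hz : InQ z) (n : ℕ) : InQ (z ^ n) := by
  induction n with
  | zero => simpa using InQ.one
  | succ k ih => rw [pow_succ]; exact ih.mul hz

lemma InQ.zpow {z : ℝ} (hz : InQ z) (n : ℤ) : InQ (z ^ n) := by
  cases n with
  | ofNat k => simpa using hz.pow k
  | negSucc k => rw [zpow_negSucc]; exact (hz.pow _).inv

lemma sqrt_conj_pow (c d : ℚ) (n : ℕ) : ∃ x y : ℚ,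
    ((c : ℝ) + d * Real.sqrt 2) ^ n = x + y * Real.sqrt 2 ∧
    ((c : ℝ) - d * Real.sqrt 2) ^ n = x - y * Real.sqrt 2 := by
  have hs : Real.sqrt 2 * Real.sqrt 2 = 2 := Real.mul_self_sqrt (by norm_num)
  induction n with
  | zero => exact ⟨1, 0, by simp, by simp⟩
  | succ k ih =>
    obtain ⟨x, y, h1, h2⟩ := ih
    refine ⟨x * c + 2 * y * d, x * d + y * c, ?_, ?_⟩
    · rw [pow_succ, h1]; push_cast; linear_combination (y : ℝ) * d * hs
    · rw [pow_succ, h2]; push_cast; linear_combination (y : ℝ) * d * hs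

lemma no_root (p : ℕ) (hp3 : 3 ≤ p) (hodd : Odd p) (c d : ℚ)
    (h : ((c : ℝ) + d * Real.sqrt 2) ^ p = 1 + Real.sqrt 2) : False := by
  have hs : Real.sqrt 2 * Real.sqrt 2 = 2 := Real.mul_self_sqrt (by norm_num)
  have hspos : 0 < Real.sqrt 2 := by positivity
  have hp0 : p ≠ 0 := by omega
  have h' : ((c : ℝ) - d * Real.sqrt 2) ^ p = 1 - Real.sqrt 2 := by
    obtain ⟨x, y, h1, h2⟩ := sqrt_conj_pow c d p
    obtain ⟨e1, e2⟩ := rat_sqrt_two_indep (x - 1) (y - 1) (by push_cast; linarith)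
    have e1 : x = 1 := by linarith
    have e2 : y = 1 := by linarith
    subst e1 e2
    rw [h2]; simp
  -- norm
  have hN : ((c : ℝ) + d * Real.sqrt 2) * (c - d * Real.sqrt 2) = -1 := by
    apply hodd.strictMono_pow.injective
    show (((c : ℝ) + d * Real.sqrt 2) * (c - d * Real.sqrt 2)) ^ p = (-1) ^ p
    rw [mul_pow, h, h', hodd.neg_one_pow]
    linear_combination -hs
  -- integrality
  have is : IsIntegral ℤ (Real.sqrt 2) := by
    apply IsIntegral.of_pow (n := 2) (by norm_num)
    rw [pow_two, hs]
    exact_mod_cast isIntegral_algebraMap (R := ℤ) (A := ℝ) (x := 2)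
  have i1 : IsIntegral ℤ ((c : ℝ) + d * Real.sqrt 2) := by
    apply IsIntegral.of_pow (n := p) (by omega)
    rw [h]
    exact isIntegral_one.add is
  have i2 : IsIntegral ℤ ((c : ℝ) - d * Real.sqrt 2) := by
    apply IsIntegral.of_pow (n := p) (by omega)
    rw [h']
    exact isIntegral_one.sub is
  have i3 : IsIntegral ℤ (algebraMap ℚ ℝ (2 * c)) := by
    have e : algebraMap ℚ ℝ (2 * c) =
        ((c : ℝ) + d * Real.sqrt 2) + ((c : ℝ) - d * Real.sqrt 2) := by
      rw [eq_ratCast]; push_cast; ring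
    rw [e]
    exact i1.add i2
  have i4 : IsIntegral ℤ (2 * c) :=
    (isIntegral_algebraMap_iff (algebraMap ℚ ℝ).injective).1 i3
  obtain ⟨m, hm⟩ := IsIntegrallyClosed.isIntegral_iff.1 i4
  have hm : (m : ℚ) = 2 * c := by simpa using hm
  have hmR : (m : ℝ) = 2 * c := by exact_mod_cast hm
  set β := (c : ℝ) + d * Real.sqrt 2 with hβ
  have b1 : 1 < β := by
    by_contra hb
    have := hodd.strictMono_pow.monotone (not_lt.1 hb)
    simp only [h, one_pow] at this
    linarith
  have b2 : β < 1 + Real.sqrt 2 := by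
    have := pow_lt_pow_right₀ b1 (show 1 < p by omega)
    rw [h] at this
    simpa using this
  have hq : β * (m : ℝ) = β ^ 2 - 1 := by
    rw [hmR]; linear_combination hN + β * hβ
  have m0 : (0 : ℝ) < m := by
    by_contra hh
    nlinarith
  have m2 : (m : ℝ) < 2 := by
    by_contra hh
    nlinarith
  have m0' : 0 < m := by exact_mod_cast m0
  have m2' : m < 2 := by exact_mod_cast m2
  have m1 : m = 1 := by omega
  subst m1
  have hc : c = 1 / 2 := by push_cast at hm; linarith
  have hd : (4 * d) * (4 * d) = 10 := by
    have : (4 * (d : ℝ)) * (4 * d) = 10 := by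
      subst hc
      push_cast at hN hβ
      rw [hβ] at hN
      nlinarith
    exact_mod_cast this
  have hsq : IsSquare ((10 : ℕ) : ℚ) := ⟨4 * d, by rw [hd]; norm_num⟩
  rw [Rat.isSquare_natCast_iff] at hsq
  obtain ⟨k, hk⟩ := hsq
  have : k < 4 := by nlinarith
  interval_cases k <;> omega

theorem not_pth_power (p : ℕ) (hp : p.Prime) (hodd : Odd p)
    (r : ℤ) (hr : ¬ (p : ℤ) ∣ r) :
    ¬ ∃ a b : ℚ, ((a : ℝ) + (b : ℝ) * Real.sqrt 2) ^ p =
      (1 + Real.sqrt 2) ^ r := by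
  rintro ⟨a, b, h⟩
  have hp3 : 3 ≤ p := by
    have := hp.two_le
    rcases hodd with ⟨k, hk⟩
    omega
  have hε : (1 + Real.sqrt 2) ≠ 0 := by positivity
  have hcop : IsCoprime (p : ℤ) r :=
    ((Nat.prime_iff_prime_int.1 hp).coprime_iff_not_dvd).2 hr
  obtain ⟨u, v, huv⟩ := hcop
  have hα : InQ ((a : ℝ) + (b : ℝ) * Real.sqrt 2) := ⟨a, b, rfl⟩
  have hεQ : InQ (1 + Real.sqrt 2) := ⟨1, 1, by simp⟩
  obtain ⟨c, d, hcd⟩ := (hα.zpow v).mul (hεQ.zpow u)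
  apply no_root p hp3 hodd c d
  rw [← hcd, mul_pow, ← zpow_natCast, ← zpow_natCast, ← zpow_mul, mul_comm v, zpow_mul,
    zpow_natCast, h, ← zpow_mul, ← zpow_mul, ← zpow_add₀ hε]
  rw [show r * v + u * (p : ℤ) = 1 by linarith, zpow_one]
end

section
/- Let p be an odd prime and let α = (1+√2)^{1/p} be the real p-th root of 1+√2. Then the degree of the field extension ℚ(α)/ℚ equals 2p; equivalently, the minimal polynomial of α over ℚ has degree 2p. -/
lemma rad_conj (x y : ℚ) (n : ℕ) : ∃ u v : ℚ,
    ((x:ℝ) + y * Real.sqrt 2) ^ n = u + v * Real.sqrt 2 ∧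
    ((x:ℝ) - y * Real.sqrt 2) ^ n = u - v * Real.sqrt 2 := by
  have h2 : Real.sqrt 2 * Real.sqrt 2 = 2 := Real.mul_self_sqrt (by norm_num)
  induction n with
  | zero => exact ⟨1, 0, by simp, by simp⟩
  | succ n ih =>
    obtain ⟨u, v, h, h'⟩ := ih
    refine ⟨u * x + 2 * v * y, u * y + v * x, ?_, ?_⟩
    · rw [pow_succ, h]; push_cast; linear_combination (v * y : ℝ) * h2
    · rw [pow_succ, h']; push_cast; linear_combination (v * y : ℝ) * h2

lemma rad_indep (u v : ℚ) (h : (1:ℝ) + Real.sqrt 2 = u + v * Real.sqrt 2) : u = 1 ∧ v = 1 := by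
  by_cases hv : v = 1
  · subst hv
    refine ⟨?_, rfl⟩
    have : (u:ℝ) = 1 := by push_cast at h; linarith
    exact_mod_cast this
  · exfalso
    apply irrational_sqrt_two
    refine ⟨(u - 1) / (1 - v), ?_⟩
    have hv' : (1 - v : ℝ) ≠ 0 := by
      intro h0; apply hv; have : (v:ℝ) = 1 := by linarith
      exact_mod_cast this
    push_cast
    rw [div_eq_iff hv']
    linarith

lemma rad_not_pow (p : ℕ) (hp3 : 3 ≤ p) (hodd : Odd p) (x y : ℚ)
    (h : ((x:ℝ) + y * Real.sqrt 2) ^ p = 1 + Real.sqrt 2) : False := by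
  have h2 : Real.sqrt 2 * Real.sqrt 2 = 2 := Real.mul_self_sqrt (by norm_num)
  have hs0 : 0 ≤ Real.sqrt 2 := Real.sqrt_nonneg 2
  have hs : Real.sqrt 2 < 2 := by nlinarith
  have hs1 : 1 < Real.sqrt 2 := by nlinarith
  obtain ⟨u, v, hu, hv⟩ := rad_conj x y p
  obtain ⟨rfl, rfl⟩ := rad_indep u v (h.symm.trans hu)
  set a : ℝ := x + y * Real.sqrt 2 with ha
  set b : ℝ := x - y * Real.sqrt 2 with hb
  have hv' : b ^ p = 1 - Real.sqrt 2 := by simpa using hv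
  have hab : a * b = -1 := by
    apply hodd.strictMono_pow.injective
    simp only [mul_pow, h, hv', hodd.neg_one_pow]
    linarith
  have hsi : IsIntegral ℤ (Real.sqrt 2) := by
    apply IsIntegral.of_pow (n := 2) (by norm_num)
    rw [pow_two, h2]
    exact isIntegral_algebraMap (x := (2:ℤ))
  have hia : IsIntegral ℤ a := IsIntegral.of_pow (by omega) (h ▸ isIntegral_one.add hsi)
  have hib : IsIntegral ℤ b := IsIntegral.of_pow (by omega) (hv' ▸ isIntegral_one.sub hsi)
  have hsum : IsIntegral ℤ ((2 * x : ℚ) : ℝ) := by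
    have : ((2 * x : ℚ) : ℝ) = a + b := by push_cast; rw [ha, hb]; ring
    rw [this]; exact hia.add hib
  have hq : IsIntegral ℤ (2 * x : ℚ) := by
    refine (isIntegral_algebraMap_iff (B := ℝ) (algebraMap ℚ ℝ).injective).1 ?_
    simpa using hsum
  obtain ⟨m, hm⟩ := IsIntegrallyClosed.isIntegral_iff.1 hq
  have hm' : a + b = (m:ℝ) := by
    have : ((2 * x : ℚ) : ℝ) = (m:ℝ) := by rw [← hm]; simp
    rw [← this]; push_cast; rw [ha, hb]; ring
  have ha1 : 1 < a := by
    apply hodd.strictMono_pow.lt_iff_lt.1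
    simp only [one_pow, h]; linarith
  have ha3 : a ^ 3 ≤ 1 + Real.sqrt 2 := h ▸ pow_le_pow_right₀ ha1.le hp3
  have hbm : -1 < b := by nlinarith
  have hm0 : (0:ℝ) < m := by rw [← hm']; linarith
  have hm1 : (1:ℝ) ≤ m := by
    have : 0 < m := by exact_mod_cast hm0
    exact_mod_cast this
  have h5 : a ^ 2 ≥ a + 1 := by nlinarith
  nlinarith

open IntermediateField Polynomial in
theorem degree_of_radical_aux (p : ℕ) (hp : p.Prime) (hodd : Odd p)
    (α : ℝ) (hα : α ^ p = 1 + Real.sqrt 2) :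
    Module.finrank ℚ (IntermediateField.adjoin ℚ {α} : IntermediateField ℚ ℝ) = 2 * p := by
  have h2 : Real.sqrt 2 * Real.sqrt 2 = 2 := Real.mul_self_sqrt (by norm_num)
  have hp3 : 3 ≤ p := by
    have := hp.two_le
    obtain ⟨k, rfl⟩ := hodd; omega
  have hsi : IsIntegral ℚ (Real.sqrt 2) := by
    apply IsIntegral.of_pow (n := 2) (by norm_num)
    rw [pow_two, h2]
    exact isIntegral_algebraMap (x := (2:ℚ))
  have hirr : Irreducible (X ^ 2 - C (2:ℚ)) := by
    apply X_pow_sub_C_irreducible_of_prime Nat.prime_two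
    intro b hb
    apply irrational_sqrt_two
    have hb' : (b:ℝ)^2 = 2 := by exact_mod_cast hb
    refine ⟨|b|, ?_⟩
    rw [← hb', Real.sqrt_sq_eq_abs]; simp
  have hK : Module.finrank ℚ ℚ⟮Real.sqrt 2⟯ = 2 := by
    rw [adjoin.finrank hsi, ← minpoly.eq_of_irreducible_of_monic hirr (by simp [pow_two, h2])
      (monic_X_pow_sub_C _ (by norm_num)), natDegree_X_pow_sub_C]
  have hform : ∀ z ∈ ℚ⟮Real.sqrt 2⟯, ∃ x y : ℚ, z = x + y * Real.sqrt 2 := by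
    intro z hz
    rw [← mem_toSubalgebra, adjoin_simple_toSubalgebra_of_isAlgebraic hsi.isAlgebraic] at hz
    induction hz using Algebra.adjoin_induction with
    | mem z hz => exact ⟨0, 1, by simpa using hz⟩
    | algebraMap r => exact ⟨r, 0, by simp⟩
    | add a b _ _ ha hb =>
      obtain ⟨x, y, rfl⟩ := ha
      obtain ⟨x', y', rfl⟩ := hb
      exact ⟨x + x', y + y', by push_cast; ring⟩
    | mul a b _ _ ha hb =>
      obtain ⟨x, y, rfl⟩ := ha
      obtain ⟨x', y', rfl⟩ := hb
      exact ⟨x * x' + 2 * y * y', x * y' + y * x', by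
        push_cast; linear_combination (y * y' : ℝ) * h2⟩
  let s : ℚ⟮Real.sqrt 2⟯ := 1 + AdjoinSimple.gen ℚ (Real.sqrt 2)
  have hs : algebraMap ℚ⟮Real.sqrt 2⟯ ℝ s = 1 + Real.sqrt 2 := by simp [s]
  have hirr2 : Irreducible (X ^ p - C s) := by
    apply X_pow_sub_C_irreducible_of_prime hp
    intro b hb
    obtain ⟨x, y, hxy⟩ := hform b b.2
    apply rad_not_pow p hp3 hodd x y
    rw [← hxy, ← hs, ← hb]; simp
  have hroot : aeval α (X ^ p - C s) = 0 := by
    rw [map_sub, aeval_C, hs]; simp [hα]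
  have hai : IsIntegral ℚ⟮Real.sqrt 2⟯ α :=
    ⟨_, monic_X_pow_sub_C s hp.ne_zero, hroot⟩
  have hL : Module.finrank ℚ⟮Real.sqrt 2⟯ ℚ⟮Real.sqrt 2⟯⟮α⟯ = p := by
    rw [adjoin.finrank hai, ← minpoly.eq_of_irreducible_of_monic hirr2 hroot
      (monic_X_pow_sub_C _ hp.ne_zero), natDegree_X_pow_sub_C]
  have heq : (ℚ⟮Real.sqrt 2⟯⟮α⟯).restrictScalars ℚ = ℚ⟮α⟯ := by
    refine (adjoin_simple_adjoin_simple ℚ (Real.sqrt 2) α).trans ?_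
    apply le_antisymm
    · rw [adjoin_le_iff]
      have hα' : α ∈ ℚ⟮α⟯ := mem_adjoin_simple_self ℚ α
      rintro z (rfl | rfl)
      · have : Real.sqrt 2 = α ^ p - 1 := by rw [hα]; ring
        rw [this]
        exact sub_mem (pow_mem hα' p) (one_mem _)
      · exact hα'
    · exact adjoin.mono _ _ _ (by simp)
  rw [← heq]
  have := Module.finrank_mul_finrank ℚ ℚ⟮Real.sqrt 2⟯ ℚ⟮Real.sqrt 2⟯⟮α⟯
  rw [hK, hL] at this
  exact this.symm

theorem degree_of_radical (p : ℕ) (hp : p.Prime) (hodd : Odd p)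
    (α : ℝ) (hα : α = (1 + Real.sqrt 2) ^ ((1 : ℝ) / (p : ℝ))) :
    Module.finrank ℚ (IntermediateField.adjoin ℚ {α} : IntermediateField ℚ ℝ)
      = 2 * p ∧ (minpoly ℚ α).natDegree = 2 * p := by
  have hpow : α ^ p = 1 + Real.sqrt 2 := by
    rw [hα, one_div, Real.rpow_inv_natCast_pow (by positivity) hp.ne_zero]
  have h := degree_of_radical_aux p hp hodd α hpow
  refine ⟨h, ?_⟩
  have hfin : FiniteDimensional ℚ (IntermediateField.adjoin ℚ {α} : IntermediateField ℚ ℝ) :=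
    Module.finite_of_finrank_pos (by rw [h]; have := hp.pos; omega)
  have hint : IsIntegral ℚ α := by
    have := IsIntegral.of_finite ℚ (IntermediateField.AdjoinSimple.gen ℚ α)
    exact (IntermediateField.AdjoinSimple.isIntegral_gen ℚ α).1 this
  rw [← IntermediateField.adjoin.finrank hint, h]
end

section
/- Let p be an odd prime, let α = (1+√2)^{1/p} (the real p-th root of 1+√2, viewed as a complex number), and let ζ_p = e^{2πi/p}. Let S = ℚ(α, ζ_p) be the subfield of ℂ generated over ℚ by α and ζ_p. Then the degree [S : ℚ] equals 2p(p−1). -/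
open IntermediateField Polynomial

lemma sqrtTwo_conj_pow (a b : ℚ) (n : ℕ) : ∃ c d : ℚ,
    ((a : ℝ) + b * √2) ^ n = c + d * √2 ∧ ((a : ℝ) - b * √2) ^ n = c - d * √2 := by
  induction n with
  | zero => exact ⟨1, 0, by simp, by simp⟩
  | succ n ih =>
    obtain ⟨c, d, h1, h2⟩ := ih
    have h : √2 * √2 = (2 : ℝ) := Real.mul_self_sqrt (by norm_num)
    refine ⟨c * a + 2 * d * b, c * b + d * a, ?_, ?_⟩
    · rw [pow_succ, h1]; push_cast; linear_combination (d * b : ℝ) * h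
    · rw [pow_succ, h2]; push_cast; linear_combination (d * b : ℝ) * h

lemma coeff_eq (c d : ℚ) (h : (1 : ℝ) + √2 = c + d * √2) : c = 1 ∧ d = 1 := by
  have hd : d = 1 := by
    by_contra hd
    have hd' : (1 - d : ℝ) ≠ 0 := by
      intro h0
      apply hd
      have : (d : ℝ) = 1 := by linarith
      exact_mod_cast this
    apply irrational_sqrt_two
    refine ⟨(c - 1) / (1 - d), ?_⟩
    push_cast
    rw [div_eq_iff hd']
    linarith
  refine ⟨?_, hd⟩
  subst hd
  have : (c : ℝ) = 1 := by push_cast at h; linarith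
  exact_mod_cast this

lemma not_pow (p : ℕ) (hp3 : 3 ≤ p) (hodd : Odd p) (a b : ℚ) :
    ((a : ℝ) + b * √2) ^ p ≠ 1 + √2 := by
  intro h
  obtain ⟨c, d, h1, h2⟩ := sqrtTwo_conj_pow a b p
  obtain ⟨rfl, rfl⟩ := coeff_eq c d (by rw [← h, h1])
  have hs : √2 * √2 = (2 : ℝ) := Real.mul_self_sqrt (by norm_num)
  have hs1 : (1 : ℝ) < √2 := by nlinarith [Real.sqrt_nonneg 2]
  have hs2 : √2 < (1.5 : ℝ) := by nlinarith [Real.sqrt_nonneg 2]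
  push_cast at h2
  set x : ℝ := a + b * √2 with hx
  set y : ℝ := a - b * √2 with hy
  have hxy : x * y = -1 := by
    apply hodd.strictMono_pow.injective
    simp only
    rw [mul_pow, h, h2, hodd.neg_one_pow]
    linear_combination -hs
  have hx1 : 1 < x := by
    by_contra hc
    push Not at hc
    have := hodd.strictMono_pow.monotone hc
    simp only [one_pow] at this
    rw [h] at this
    linarith
  have hx2 : x < 1.5 := by
    by_contra hc
    push Not at hc
    have h3 : x ^ 3 ≤ x ^ p := pow_le_pow_right₀ hx1.le hp3
    have h4 : (1.5 : ℝ) ^ 3 ≤ x ^ 3 := by gcongr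
    rw [h] at h3
    norm_num at h4 hs2
    linarith
  have hint : IsIntegral ℤ (x + y) := by
    have hi2 : IsIntegral ℤ (√2 : ℝ) := by
      refine IsIntegral.of_pow (n := 2) (by norm_num) ?_
      rw [sq, hs]
      exact isIntegral_algebraMap (R := ℤ) (x := 2)
    have h1' : IsIntegral ℤ (1 : ℝ) := isIntegral_one
    refine IsIntegral.add (IsIntegral.of_pow (n := p) (by omega) ?_)
      (IsIntegral.of_pow (n := p) (by omega) ?_)
    · rw [h]; exact h1'.add hi2
    · rw [h2]; simpa using h1'.sub hi2
  have hxyq : x + y = algebraMap ℚ ℝ (2 * a) := by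
    simp [hx, hy]; ring
  rw [hxyq, isIntegral_algebraMap_iff (algebraMap ℚ ℝ).injective] at hint
  obtain ⟨m, hm⟩ := IsIntegrallyClosed.isIntegral_iff.mp hint
  have hm' : x + y = m := by
    rw [hxyq, ← hm]; simp
  have hy0 : -1 < y := by nlinarith
  have hy1 : y < -0.6 := by nlinarith
  have l1 : (0 : ℝ) < m := by linarith
  have l2 : (m : ℝ) < 1 := by norm_num at *; linarith
  have l1' : 0 < m := by exact_mod_cast l1
  have l2' : m < 1 := by exact_mod_cast l2
  omega

lemma mem_sqrt2 (x : ℂ) (hx : x ∈ ℚ⟮((√2 : ℝ) : ℂ)⟯) :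
    ∃ a b : ℚ, x = (((a : ℝ) + b * √2 : ℝ) : ℂ) := by
  have hs : √2 * √2 = (2 : ℝ) := Real.mul_self_sqrt (by norm_num)
  have halg : IsAlgebraic ℚ ((√2 : ℝ) : ℂ) := by
    refine IsIntegral.isAlgebraic (IsIntegral.of_pow (n := 2) (by norm_num) ?_)
    have : ((√2 : ℝ) : ℂ) ^ 2 = algebraMap ℚ ℂ 2 := by
      rw [sq, ← Complex.ofReal_mul, hs]; simp
    rw [this]; exact isIntegral_algebraMap
  rw [← IntermediateField.mem_toSubalgebra,
    adjoin_simple_toSubalgebra_of_isAlgebraic halg] at hx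
  induction hx using Algebra.adjoin_induction with
  | mem x hx => 
    rw [Set.mem_singleton_iff] at hx
    exact ⟨0, 1, by simp [hx]⟩
  | algebraMap r => exact ⟨r, 0, by simp⟩
  | add x y _ _ h1 h2 =>
    obtain ⟨a, b, rfl⟩ := h1
    obtain ⟨c, d, rfl⟩ := h2
    exact ⟨a + c, b + d, by push_cast; ring⟩
  | mul x y _ _ h1 h2 =>
    obtain ⟨a, b, rfl⟩ := h1
    obtain ⟨c, d, rfl⟩ := h2
    refine ⟨a * c + 2 * b * d, a * d + b * c, ?_⟩
    rw [← Complex.ofReal_mul]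
    congr 1
    push_cast
    linear_combination (b * d : ℝ) * hs

lemma finrank_sqrt2 : Module.finrank ℚ ℚ⟮((√2 : ℝ) : ℂ)⟯ = 2 := by
  have hs : √2 * √2 = (2 : ℝ) := Real.mul_self_sqrt (by norm_num)
  have hirr : Irreducible (X ^ 2 - C (2 : ℚ)) := by
    apply X_pow_sub_C_irreducible_of_prime Nat.prime_two
    intro b hb
    apply irrational_sqrt_two
    refine ⟨|b|, ?_⟩
    have : (b : ℝ) ^ 2 = 2 := by exact_mod_cast hb
    rw [← this, Real.sqrt_sq_eq_abs]; simp
  have hm : X ^ 2 - C (2 : ℚ) = minpoly ℚ ((√2 : ℝ) : ℂ) := by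
    apply minpoly.eq_of_irreducible_of_monic hirr
    · simp only [map_sub, map_pow, aeval_X, aeval_C]
      rw [sq, ← Complex.ofReal_mul, hs]; simp
    · exact monic_X_pow_sub_C _ (by norm_num)
  have hint : IsIntegral ℚ ((√2 : ℝ) : ℂ) := by
    by_contra hc
    rw [minpoly.eq_zero hc] at hm
    exact hirr.ne_zero hm
  rw [adjoin.finrank hint, ← hm, natDegree_X_pow_sub_C]

lemma dvd_of_le {A B : IntermediateField ℚ ℂ} (h : A ≤ B) :
    Module.finrank ℚ A ∣ Module.finrank ℚ B := 
  finrank_dvd_of_le_right h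

lemma finrank_pow (p : ℕ) (hp : p.Prime) (hodd : Odd p) (α : ℂ)
    (hα : α ^ p = ((1 + √2 : ℝ) : ℂ)) : Module.finrank ℚ ℚ⟮α⟯ = 2 * p := by
  have hp3 : 3 ≤ p := by
    have := hp.two_le
    rcases hodd with ⟨k, rfl⟩
    omega
  set K := ℚ⟮((√2 : ℝ) : ℂ)⟯ with hK
  have hsK : ((√2 : ℝ) : ℂ) ∈ K := mem_adjoin_simple_self ℚ _
  let u : K := 1 + ⟨_, hsK⟩
  have hu : algebraMap K ℂ u = ((1 + √2 : ℝ) : ℂ) := by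
    rw [map_add, map_one]
    push_cast
    rfl
  have hirr : Irreducible (X ^ p - C u) := by
    apply X_pow_sub_C_irreducible_of_prime hp
    intro b hb
    obtain ⟨c, d, h⟩ := mem_sqrt2 b b.2
    apply not_pow p hp3 hodd c d
    have := congrArg (algebraMap K ℂ) hb
    rw [hu, map_pow] at this
    change (b : ℂ) ^ p = _ at this
    rw [h] at this
    exact_mod_cast this
  have hm : X ^ p - C u = minpoly K α := by
    apply minpoly.eq_of_irreducible_of_monic hirr
    · simp only [map_sub, map_pow, aeval_X, aeval_C]
      rw [hu, hα, sub_self]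
    · exact monic_X_pow_sub_C _ (by omega)
  have hint : IsIntegral K α := by
    by_contra hc
    rw [minpoly.eq_zero hc] at hm
    exact hirr.ne_zero hm
  have hf : Module.finrank K K⟮α⟯ = p := by
    rw [adjoin.finrank hint, ← hm, natDegree_X_pow_sub_C]
  have hf2 : Module.finrank ℚ (K⟮α⟯.restrictScalars ℚ) = 2 * p := by
    rw [← finrank_sqrt2, ← hf]
    exact (Module.finrank_mul_finrank ℚ K K⟮α⟯).symm
  have heq : K⟮α⟯.restrictScalars ℚ = ℚ⟮α⟯ := by
    refine (adjoin_simple_adjoin_simple ℚ ((√2 : ℝ) : ℂ) α).trans ?_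
    apply le_antisymm
    · rw [adjoin_le_iff]
      have ha := mem_adjoin_simple_self ℚ α
      rintro x (rfl | rfl)
      · have h1 : ((√2 : ℝ) : ℂ) = α ^ p - 1 := by rw [hα]; push_cast; ring
        rw [h1]
        exact sub_mem (pow_mem ha _) (one_mem _)
      · exact ha
    · exact adjoin.mono _ _ _ (by simp)
  rw [← heq, hf2]

lemma finrank_root (n : ℕ) (hn : 0 < n) (ζ : ℂ) (h : IsPrimitiveRoot ζ n) :
    Module.finrank ℚ ℚ⟮ζ⟯ = n.totient := by
  rw [adjoin.finrank ((h.isIntegral hn).tower_top), ← cyclotomic_eq_minpoly_rat h hn,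
    natDegree_cyclotomic]

lemma dvd_cyc (p : ℕ) (hp : p.Prime) (hodd : Odd p) (ζ : ℂ) (h : IsPrimitiveRoot ζ p)
    (S : IntermediateField ℚ ℂ) (hζ : ζ ∈ S) (hs : ((√2 : ℝ) : ℂ) ∈ S) :
    2 * (p - 1) ∣ Module.finrank ℚ S := by
  have h8 := Complex.isPrimitiveRoot_exp 8 (by norm_num)
  set w : ℂ := Complex.exp (2 * Real.pi * Complex.I / (8 : ℕ)) with hw
  have hcop : Nat.Coprime p 8 := by
    have : Nat.Coprime p (2 ^ 3) := (Nat.coprime_two_right.mpr hodd).pow_right 3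
    simpa using this
  have hprim : IsPrimitiveRoot (ζ * w) (p * 8) := by
    rw [IsPrimitiveRoot.iff_orderOf] at *
    rw [(Commute.all ζ w).orderOf_mul_eq_mul_orderOf_of_coprime (by rw [h, h8]; exact hcop), h, h8]
  have h1 : Module.finrank ℚ ℚ⟮ζ * w⟯ = (p - 1) * 4 := by
    rw [finrank_root _ (by have := hp.pos; omega) _ hprim, Nat.totient_mul hcop,
      Nat.totient_prime hp]
    rfl
  have hww : w ^ 2 - ((√2 : ℝ) : ℂ) * w + 1 = 0 := by
    have hss : ((√2 : ℝ) : ℂ) * ((√2 : ℝ) : ℂ) = 2 := by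
      rw [← Complex.ofReal_mul, Real.mul_self_sqrt (by norm_num)]; simp
    have : w = ((√2 / 2 : ℝ) : ℂ) + ((√2 / 2 : ℝ) : ℂ) * Complex.I := by
      have e : (2 * Real.pi * Complex.I / (8 : ℕ) : ℂ) = ((Real.pi / 4 : ℝ) : ℂ) * Complex.I := by
        push_cast; ring
      rw [hw, e, Complex.exp_mul_I, ← Complex.ofReal_cos, ← Complex.ofReal_sin,
        Real.cos_pi_div_four, Real.sin_pi_div_four]
    rw [this]
    push_cast
    linear_combination (1 / 4 * Complex.I ^ 2 - 1 / 4) * hss + 1 / 2 * Complex.I_sq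
  let s : S := ⟨_, hs⟩
  let P : S[X] := X ^ 2 - C s * X + 1
  have hPm : P.Monic := by simp only [P]; monicity!
  have hPd : P.natDegree = 2 := by simp only [P]; compute_degree!
  have hP0 : aeval w P = 0 := by
    simp only [P, map_add, map_sub, map_pow, map_mul, aeval_X, aeval_C, map_one]
    exact hww
  have hint : IsIntegral S w := ⟨P, hPm, hP0⟩
  have hle : Module.finrank S S⟮w⟯ ≤ 2 := by
    rw [adjoin.finrank hint, ← hPd]
    exact natDegree_le_of_dvd (minpoly.dvd _ _ hP0) hPm.ne_zero
  have hpos : 0 < Module.finrank S S⟮w⟯ := by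
    rw [adjoin.finrank hint]
    exact minpoly.natDegree_pos hint
  have hT : Module.finrank ℚ (S⟮w⟯.restrictScalars ℚ)
      = Module.finrank ℚ S * Module.finrank S S⟮w⟯ :=
    (Module.finrank_mul_finrank ℚ S S⟮w⟯).symm
  have hd : (p - 1) * 4 ∣ Module.finrank ℚ S * Module.finrank S S⟮w⟯ := by
    rw [← h1, ← hT]
    apply dvd_of_le
    rw [adjoin_simple_le_iff]
    change ζ * w ∈ S⟮w⟯
    exact mul_mem (S⟮w⟯.algebraMap_mem ⟨ζ, hζ⟩) (mem_adjoin_simple_self S w)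
  generalize Module.finrank S S⟮w⟯ = d at *
  obtain rfl | rfl : d = 1 ∨ d = 2 := by omega
  · rw [mul_one] at hd
    exact Dvd.dvd.trans ⟨2, by ring⟩ hd
  · have : (2 * (p - 1)) * 2 ∣ Module.finrank ℚ S * 2 := by
      convert hd using 1; ring
    exact Nat.dvd_of_mul_dvd_mul_right (by norm_num) this

theorem degree_of_S (p : ℕ) (hp : p.Prime) (hodd : Odd p)
    (α ζ : ℂ)
    (hα : α = ((1 + Real.sqrt 2) ^ ((1 : ℝ) / (p : ℝ)) : ℝ))
    (hζ : ζ = Complex.exp (2 * Real.pi * Complex.I / (p : ℂ))) :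
    Module.finrank ℚ (IntermediateField.adjoin ℚ {α, ζ} : IntermediateField ℚ ℂ)
      = 2 * p * (p - 1) := by
  have hprim : IsPrimitiveRoot ζ p := hζ ▸ Complex.isPrimitiveRoot_exp p hp.ne_zero
  have hpow : α ^ p = ((1 + √2 : ℝ) : ℂ) := by
    rw [hα, ← Complex.ofReal_pow, one_div, Real.rpow_inv_natCast_pow (by positivity) hp.ne_zero]
  have hA := finrank_pow p hp hodd α hpow
  have hZ := finrank_root p hp.pos ζ hprim
  rw [Nat.totient_prime hp] at hZ
  have hsup : IntermediateField.adjoin ℚ {α, ζ} = ℚ⟮α⟯ ⊔ ℚ⟮ζ⟯ := by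
    rw [← adjoin_union]; rfl
  have hαS : α ∈ IntermediateField.adjoin ℚ {α, ζ} := subset_adjoin _ _ (by simp)
  have hζS : ζ ∈ IntermediateField.adjoin ℚ {α, ζ} := subset_adjoin _ _ (by simp)
  have hsS : ((√2 : ℝ) : ℂ) ∈ IntermediateField.adjoin ℚ {α, ζ} := by
    have h1 : ((√2 : ℝ) : ℂ) = α ^ p - 1 := by rw [hpow]; push_cast; ring
    rw [h1]
    exact sub_mem (pow_mem hαS _) (one_mem _)
  have d1 : 2 * p ∣ Module.finrank ℚ (IntermediateField.adjoin ℚ {α, ζ}) := by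
    rw [← hA]
    exact dvd_of_le (by rw [adjoin_simple_le_iff]; exact hαS)
  have d2 := dvd_cyc p hp hodd ζ hprim _ hζS hsS
  have hub : Module.finrank ℚ (IntermediateField.adjoin ℚ {α, ζ}) ≤ 2 * p * (p - 1) := by
    rw [← hA, ← hZ, hsup]
    exact finrank_sup_le _ _
  have hp2 := hp.two_le
  have : FiniteDimensional ℚ ℚ⟮α⟯ := Module.finite_of_finrank_pos (by rw [hA]; omega)
  have : FiniteDimensional ℚ ℚ⟮ζ⟯ := Module.finite_of_finrank_pos (by rw [hZ]; omega)
  have hpos : 0 < Module.finrank ℚ (IntermediateField.adjoin ℚ {α, ζ}) := by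
    rw [hsup]; exact Module.finrank_pos
  apply le_antisymm hub
  apply Nat.le_of_dvd hpos
  obtain ⟨m, hm⟩ := d1
  rw [hm, mul_assoc] at d2
  rw [hm, mul_assoc, mul_assoc]
  have d3 : p - 1 ∣ p * m := Nat.dvd_of_mul_dvd_mul_left (by norm_num) d2
  have hc : Nat.Coprime (p - 1) p := by
    have := Nat.coprime_self_add_right (m := p - 1) (n := 1)
    rw [Nat.sub_add_cancel hp.one_le] at this
    simpa using this
  exact mul_dvd_mul_left 2 (mul_dvd_mul_left p (hc.dvd_of_dvd_mul_left d3))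
end

section
/- Let p be an odd prime and let r be an integer not divisible by p. Define the real function F(x) = (1+√2)^r · (x+√2)^p − (1−√2)^r · (x−√2)^p, where (1±√2)^r denotes integer powers (allowing negative r). Then the real number θ = √2 + 2√2/((−1)^r · (1+√2)^{−2r/p} − 1) satisfies F(θ) = 0, and θ is the unique real number x with F(x) = 0. -/
theorem unique_real_root (p : ℕ) (hp : p.Prime) (hodd : Odd p)
    (r : ℤ) (hr : ¬ (p : ℤ) ∣ r)
    (F : ℝ → ℝ)
    (hF : F = fun t : ℝ =>
      (1 + Real.sqrt 2) ^ r * (t + Real.sqrt 2) ^ p -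
      (1 - Real.sqrt 2) ^ r * (t - Real.sqrt 2) ^ p)
    (θ : ℝ)
    (hθ : θ = Real.sqrt 2 + 2 * Real.sqrt 2 /
      ((-1 : ℝ) ^ r * (1 + Real.sqrt 2) ^ ((-2 * (r : ℝ)) / (p : ℝ)) - 1)) :
    F θ = 0 ∧ ∀ t : ℝ, F t = 0 → t = θ := by
  have hs : Real.sqrt 2 * Real.sqrt 2 = 2 := Real.mul_self_sqrt (by norm_num)
  have hs0 : 0 < Real.sqrt 2 := Real.sqrt_pos.mpr (by norm_num)
  have ha0 : 0 < 1 + Real.sqrt 2 := by linarith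
  have ha1 : 1 < 1 + Real.sqrt 2 := by linarith
  have hp0 : (p : ℝ) ≠ 0 := by exact_mod_cast hp.ne_zero
  have hr0 : r ≠ 0 := by rintro rfl; exact hr (dvd_zero _)
  have hb : 1 - Real.sqrt 2 = (-1) * (1 + Real.sqrt 2)⁻¹ := by
    field_simp
    nlinarith
  set s := Real.sqrt 2 with hsdef
  set u : ℝ := (1 + s) ^ ((-2 * (r : ℝ)) / (p : ℝ)) with hu
  have hu0 : 0 < u := Real.rpow_pos_of_pos ha0 _
  have hup : u ^ p = (1 + s) ^ (-2 * r) := by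
    rw [hu, ← Real.rpow_natCast, ← Real.rpow_mul ha0.le, div_mul_cancel₀ _ hp0,
      ← Real.rpow_intCast]
    push_cast
    rfl
  have hu1 : u ≠ 1 := by
    intro h
    rw [h, one_pow] at hup
    have := (zpow_eq_one_iff_right₀ ha0.le ha1.ne').mp hup.symm
    omega
  have hkk : ((-1 : ℝ) ^ r) ^ p = (-1) ^ r := by
    rcases Int.even_or_odd r with h | h
    · rw [h.neg_one_zpow, one_pow]
    · rw [h.neg_one_zpow, hodd.neg_one_pow]
  set k : ℝ := (-1 : ℝ) ^ r * u with hk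
  have hk1 : k - 1 ≠ 0 := by
    rcases Int.even_or_odd r with h | h
    · rw [hk, h.neg_one_zpow, one_mul]
      exact sub_ne_zero.mpr hu1
    · rw [hk, h.neg_one_zpow]
      intro h'
      linarith
  have hkp : (1 - s) ^ r = (1 + s) ^ r * k ^ p := by
    rw [hk, mul_pow, hkk, hup, hb, mul_zpow, inv_zpow', mul_left_comm, ← zpow_add₀ ha0.ne']
    congr 2
    ring
  have key : ∀ t, F t = 0 ↔ t + s = k * (t - s) := by
    intro t
    have hne : (1 + s) ^ r ≠ 0 := (zpow_pos ha0 r).ne'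
    have e : F t = (1 + s) ^ r * ((t + s) ^ p - (k * (t - s)) ^ p) := by
      rw [hF]
      simp only
      rw [hkp, mul_pow k (t - s) p]
      ring
    rw [e, mul_eq_zero, or_iff_right hne, sub_eq_zero]
    exact hodd.strictMono_pow.injective.eq_iff
  have hθ2 : (θ - s) * (k - 1) = 2 * s := by
    rw [hθ]
    field_simp
    ring
  constructor
  · rw [key]
    linarith
  · intro t ht
    rw [key] at ht
    apply mul_right_cancel₀ hk1
    linarith
end

section
/- Let p be an odd prime and for i = 1, …, p−1 define the complex numbers ρ_i = √2 − 2√2/((1+√2)^{−2/p}·e^{2πi·i/p} + 1). Then the product of the absolute values of their imaginary parts satisfies ∏_{i=1}^{p−1} |Im ρ_i| ≥ p · 2^{(p−3)/2}. -/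
lemma aux_im (q : ℝ) (z : ℂ) (hz : ‖z‖ = 1) (hq : 0 < q) :
    |((Real.sqrt 2 : ℂ) - 2 * (Real.sqrt 2 : ℂ) / ((q : ℂ) * z + 1)).im| =
      (Real.sqrt 2 * q) * ‖1 - z ^ 2‖ / ‖1 + z * q‖ ^ 2 := by
  have h1 : ‖1 - z ^ 2‖ = 2 * |z.im| := by
    have hc : (starRingEnd ℂ) z * z = 1 := by
      rw [mul_comm, Complex.mul_conj, Complex.normSq_eq_norm_sq, hz]; simp
    have h2 : 1 - z ^ 2 = -((z - (starRingEnd ℂ) z) * z) := by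
      rw [sub_mul, hc]; ring
    rw [h2, norm_neg, norm_mul, hz, mul_one, Complex.sub_conj]
    simp
  have h3 : ((Real.sqrt 2 : ℂ) - 2 * (Real.sqrt 2 : ℂ) / ((q : ℂ) * z + 1)).im =
      (2 * Real.sqrt 2 * q * z.im) / ‖1 + z * q‖ ^ 2 := by
    rw [← Complex.normSq_eq_norm_sq, show (1 + z * q : ℂ) = q * z + 1 by ring]
    rw [show (2 * (Real.sqrt 2 : ℂ)) = ((2 * Real.sqrt 2 : ℝ) : ℂ) by push_cast; ring]
    rw [Complex.sub_im, div_eq_mul_inv, Complex.im_ofReal_mul, Complex.inv_im,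
      Complex.ofReal_im, Complex.add_im, Complex.im_ofReal_mul, Complex.one_im]
    ring
  rw [h3, h1, abs_div, abs_mul, abs_mul, abs_mul, abs_of_pos hq, abs_of_nonneg (Real.sqrt_nonneg 2),
    abs_of_pos (two_pos), abs_of_nonneg (by positivity : 0 ≤ ‖1 + z * q‖ ^ 2)]
  ring

lemma aux_q (q : ℝ) (n : ℕ) (hn : q ^ (n+1) = (1 + Real.sqrt 2) ^ (-2 : ℝ)) (hq : 0 < q) (B : ℝ)
    (hB : (1 + q) * B = 1 + q ^ (n+1)) : B ^ 2 ≤ 2 * q ^ n := by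
  have hs : Real.sqrt 2 ^ 2 = 2 := Real.sq_sqrt (by norm_num)
  have hs0 : 0 ≤ Real.sqrt 2 := Real.sqrt_nonneg 2
  have h8 : (1 + q ^ (n+1)) ^ 2 = 8 * q ^ (n+1) := by
    have : q ^ (n+1) = 3 - 2 * Real.sqrt 2 := by
      rw [hn, Real.rpow_neg (by positivity)]
      norm_cast
      apply inv_eq_of_mul_eq_one_right
      nlinarith
    rw [this]; nlinarith
  have h4 : (1 + q) ^ 2 * B ^ 2 ≤ (1 + q) ^ 2 * (2 * q ^ n) := by
    rw [← mul_pow, hB, h8, pow_succ]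
    have : 0 < q ^ n := by positivity
    nlinarith [mul_nonneg this.le (sq_nonneg (1 - q))]
  exact le_of_mul_le_mul_left h4 (by positivity)

theorem product_of_imag_parts (p : ℕ) (hp : p.Prime) (hodd : Odd p)
    (ρ : ℕ → ℂ)
    (hρ : ∀ i, ρ i = (Real.sqrt 2 : ℂ) - 2 * (Real.sqrt 2 : ℂ) /
      (((1 + Real.sqrt 2) ^ ((-2 : ℝ) / (p : ℝ)) : ℝ) *
        Complex.exp (2 * Real.pi * Complex.I * (i : ℂ) / (p : ℂ)) + 1)) :
    ∏ i ∈ Finset.Icc 1 (p - 1), |(ρ i).im| ≥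
      (p : ℝ) * (2 : ℝ) ^ (((p : ℝ) - 3) / 2) := by
  obtain ⟨n, rfl⟩ : ∃ n, p = n + 1 := ⟨p - 1, by have := hp.pos; omega⟩
  have hs0 : 0 < Real.sqrt 2 := by positivity
  set q : ℝ := (1 + Real.sqrt 2) ^ ((-2 : ℝ) / ((n + 1 : ℕ) : ℝ)) with hqdef
  have hq : 0 < q := by positivity
  have hqn : q ^ (n+1) = (1 + Real.sqrt 2) ^ (-2 : ℝ) := by
    rw [hqdef, ← Real.rpow_natCast, ← Real.rpow_mul (by positivity), div_mul_cancel₀]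
    positivity
  set ζ : ℂ := Complex.exp (2 * Real.pi * Complex.I / ((n + 1 : ℕ) : ℂ)) with hζdef
  have hζ : IsPrimitiveRoot ζ (n+1) := Complex.isPrimitiveRoot_exp _ (by omega)
  have hζ2 : IsPrimitiveRoot (ζ ^ 2) (n+1) := hζ.pow_of_coprime 2 (by simpa using hodd)
  have hζn : ‖ζ‖ = 1 := hζ.norm'_eq_one (by omega)
  have hA : ∏ k ∈ Finset.range n, ‖1 - (ζ ^ (k + 1)) ^ 2‖ = (n : ℝ) + 1 := by
    have := congrArg norm hζ2.prod_one_sub_pow_eq_order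
    rw [norm_prod] at this
    simp only [← pow_mul] at this ⊢
    simp only [mul_comm 2] at this
    rw [this]
    norm_cast
  have hB : (1 + q) * ∏ k ∈ Finset.range n, ‖1 + ζ ^ (k + 1) * q‖ = 1 + q ^ (n+1) := by
    have h := congrArg (Polynomial.eval 1)
      (X_pow_sub_C_eq_prod hζ (Nat.succ_pos n) (rfl : (-(q:ℂ)) ^ (n+1) = _))
    rw [Polynomial.eval_prod, hodd.neg_pow] at h
    simp only [Polynomial.eval_sub, Polynomial.eval_pow, Polynomial.eval_X, Polynomial.eval_C,
      mul_neg, sub_neg_eq_add, one_pow] at h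
    rw [Finset.prod_range_succ'] at h
    have h' := congrArg norm h
    rw [norm_mul, norm_prod, pow_zero, one_mul] at h'
    rw [show (1 + (q:ℂ)) = ((1 + q : ℝ) : ℂ) by push_cast; ring,
      show (1 + (q:ℂ) ^ (n+1)) = ((1 + q ^ (n+1) : ℝ) : ℂ) by push_cast; ring,
      Complex.norm_of_nonneg (by positivity), Complex.norm_of_nonneg (by positivity)] at h'
    rw [h', mul_comm]
  have hprod : ∏ i ∈ Finset.Icc 1 (n + 1 - 1), |(ρ i).im| =
      (Real.sqrt 2 * q) ^ n * ((n : ℝ) + 1) /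
        (∏ k ∈ Finset.range n, ‖1 + ζ ^ (k + 1) * q‖) ^ 2 := by
    have hI : Finset.Icc 1 (n + 1 - 1) = Finset.Ico 1 (n + 1) := by
      ext; simp only [Finset.mem_Icc, Finset.mem_Ico]; omega
    rw [hI, Finset.prod_Ico_eq_prod_range, ← hA, ← Finset.prod_pow]
    have hc : (Real.sqrt 2 * q) ^ n = ∏ _k ∈ Finset.range n, (Real.sqrt 2 * q) := by simp
    rw [hc, ← Finset.prod_mul_distrib, ← Finset.prod_div_distrib, Nat.add_sub_cancel]
    refine Finset.prod_congr rfl fun k _ => ?_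
    have he : Complex.exp (2 * Real.pi * Complex.I * ((1 + k : ℕ) : ℂ) / ((n + 1 : ℕ) : ℂ)) =
        ζ ^ (k + 1) := by
      rw [hζdef, ← Complex.exp_nat_mul]
      congr 1
      push_cast; ring
    rw [hρ, he]
    exact aux_im q _ (by rw [norm_pow, hζn, one_pow]) hq
  have hle := aux_q q n hqn hq _ hB
  have hBpos : 0 < ∏ k ∈ Finset.range n, ‖1 + ζ ^ (k + 1) * q‖ := by
    have : 0 < 1 + q ^ (n+1) := by positivity
    rw [← hB] at this
    exact (mul_pos_iff_of_pos_left (by positivity)).1 this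
  have h2 : (2 : ℝ) ^ ((((n + 1 : ℕ) : ℝ) - 3) / 2) = Real.sqrt 2 ^ n / 2 := by
    rw [Real.sqrt_eq_rpow, ← Real.rpow_natCast, ← Real.rpow_mul (by norm_num)]
    rw [eq_div_iff (by norm_num)]
    rw [← Real.rpow_add_one (by norm_num)]
    congr 1
    push_cast; ring
  rw [hprod, h2, ge_iff_le, le_div_iff₀ (by positivity), mul_pow]
  push_cast
  have : 0 ≤ ((n : ℝ) + 1) * (Real.sqrt 2 ^ n / 2) := by positivity
  nlinarith [mul_le_mul_of_nonneg_left hle this]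
end

section
/- Let p ≥ 3 be a prime, let x, y be integers with x² − 2 = y^p and y ≠ −1, and let a, b be integers such that, as real numbers, x + √2 = (1+√2)·(a + b√2)^p. Then there exists a prime ℓ with ℓ ∣ b and ℓ ≡ 1 (mod p). -/
theorem aux_binom {R : Type*} [CommRing R] (p : ℕ) (hp : p.Prime) (hp3 : 3 ≤ p) (x y : R) :
    ∃ M : R, (x + y) ^ p = x ^ p + y ^ p + p * x ^ (p - 1) * y + p * y ^ 2 * M := by
  obtain ⟨n, rfl⟩ : ∃ n, p = n + 3 := ⟨p - 3, by omega⟩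
  have key : ((n + 3 : ℕ) : R) * y ^ 2 ∣ ∑ i ∈ Finset.range (n + 1),
      y ^ (i + 1 + 1) * x ^ (n + 3 - (i + 1 + 1)) * ((n + 3).choose (i + 1 + 1) : R) := by
    apply Finset.dvd_sum
    intro i hi
    have hi' := Finset.mem_range.1 hi
    obtain ⟨c, hc⟩ := hp.dvd_choose_self (k := i + 1 + 1) (by omega) (by omega)
    rw [hc]
    refine ⟨y ^ i * x ^ (n + 3 - (i + 1 + 1)) * c, ?_⟩
    push_cast
    ring
  obtain ⟨M, hM⟩ := key
  refine ⟨M, ?_⟩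
  rw [add_comm x y, add_pow, Finset.sum_range_succ, Finset.sum_range_succ',
    Finset.sum_range_succ', hM]
  simp
  ring

theorem aux_dvd (p : ℕ) (hp : p.Prime) (hp3 : 3 ≤ p) (a b K : ℤ)
    (hK : a ^ p - 1 = b * K) (hKp : (p : ℤ) ∣ b → (p : ℤ) ∣ K)
    (hno : ∀ q : ℕ, q.Prime → (q : ℤ) ∣ b → ¬ q ≡ 1 [MOD p]) : b ∣ a - 1 := by
  have hpp : Prime (p : ℤ) := Nat.prime_iff_prime_int.1 hp
  set S : ℤ := ∑ i ∈ Finset.range p, a ^ i with hS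
  have hSa : S * (a - 1) = a ^ p - 1 := geom_sum_mul a p
  have hq : ∀ q : ℕ, q.Prime → (q : ℤ) ∣ b → (q : ℤ) ∣ S → q = p := by
    intro q hqp hqb hqS
    by_contra hne
    apply hno q hqp hqb
    have := Fact.mk hqp
    have := Fact.mk hp
    have h1 : ((a : ZMod q)) ^ p = 1 := by
      have : (q : ℤ) ∣ a ^ p - 1 := hK ▸ Dvd.dvd.mul_right hqb K
      have := (ZMod.intCast_zmod_eq_zero_iff_dvd _ q).2 this
      push_cast at this
      exact sub_eq_zero.1 this
    have h2 : (a : ZMod q) ≠ 1 := by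
      intro h2
      have := (ZMod.intCast_zmod_eq_zero_iff_dvd _ q).2 hqS
      rw [hS] at this
      push_cast at this
      simp [h2] at this
      rw [ZMod.natCast_eq_zero_iff] at this
      exact hne ((Nat.prime_dvd_prime_iff_eq hqp hp).1 this)
    have h3 := orderOf_eq_prime h1 h2
    have h0 : (a : ZMod q) ≠ 0 := by
      intro h0
      rw [h0, zero_pow hp.ne_zero] at h1
      exact zero_ne_one h1
    have h4 := ZMod.orderOf_dvd_card_sub_one h0
    rw [h3] at h4
    exact ((Nat.modEq_iff_dvd' hqp.one_le).2 h4).symm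
  by_cases hpb : (p : ℤ) ∣ b
  · obtain ⟨K', hK'⟩ := hKp hpb
    have hpa : (p : ℤ) ∣ a - 1 := by
      have := Fact.mk hp
      have : (p : ℤ) ∣ a ^ p - 1 := hK ▸ Dvd.dvd.mul_right hpb K
      have := (ZMod.intCast_zmod_eq_zero_iff_dvd _ p).2 this
      push_cast at this
      rw [ZMod.pow_card] at this
      apply (ZMod.intCast_zmod_eq_zero_iff_dvd _ p).1
      push_cast
      exact this
    obtain ⟨k, hk⟩ := hpa
    have hodd : Odd p := hp.odd_of_ne_two (by omega)
    have h5 := odd_sq_dvd_geom_sum₂_sub (R := ℤ) 1 k hodd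
    have hak : (1 : ℤ) + p * k = a := by linarith
    simp only [hak, one_pow, mul_one] at h5
    rw [← hS] at h5
    obtain ⟨j, hj⟩ := h5
    have hS' : S = p * (1 + p * j) := by linarith
    have hp0 : (p : ℤ) ≠ 0 := hpp.ne_zero
    have h6 : (1 + p * j) * (a - 1) = b * K' := by
      apply mul_left_cancel₀ hp0
      rw [← mul_assoc, ← hS', hSa, hK, hK']
      ring
    have hcop : IsCoprime b (1 + p * j) := by
      rw [Int.isCoprime_iff_gcd_eq_one]
      by_contra hg
      obtain ⟨q, hqp, hqd⟩ := Nat.exists_prime_and_dvd hg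
      have hd : (q : ℤ) ∣ (Int.gcd b (1 + p * j) : ℤ) := Int.natCast_dvd_natCast.2 hqd
      have hd1 := hd.trans (Int.gcd_dvd_left ..)
      have hd2 := hd.trans (Int.gcd_dvd_right ..)
      have := hq q hqp hd1 (hS' ▸ Dvd.dvd.mul_left hd2 _)
      subst this
      have : (q : ℤ) ∣ 1 := by
        have := dvd_sub hd2 (Dvd.intro j rfl)
        simpa using this
      exact hpp.not_dvd_one this
    exact hcop.dvd_of_dvd_mul_left (Dvd.intro _ h6.symm)
  · have hcop : IsCoprime b S := by
      rw [Int.isCoprime_iff_gcd_eq_one]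
      by_contra hg
      obtain ⟨q, hqp, hqd⟩ := Nat.exists_prime_and_dvd hg
      have hd : (q : ℤ) ∣ (Int.gcd b S : ℤ) := Int.natCast_dvd_natCast.2 hqd
      have hd1 := hd.trans (Int.gcd_dvd_left ..)
      have hd2 := hd.trans (Int.gcd_dvd_right ..)
      have := hq q hqp hd1 hd2
      subst this
      exact hpb hd1
    exact hcop.dvd_of_dvd_mul_left (Dvd.intro K (by rw [hSa, hK]))

/-- Case `b > 0`. -/
theorem aux_pos (p : ℕ) (hp3 : 3 ≤ p) (hodd : Odd p) (a b : ℤ) (hb : 0 < b) (hd : b ∣ a - 1)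
    (hT : (1 + √2) * ((a : ℝ) + b * √2) ^ p + (√2 - 1) * ((a : ℝ) - b * √2) ^ p = 2 * √2) :
    False := by
  have s2 : √2 * √2 = (2 : ℝ) := Real.mul_self_sqrt (by norm_num)
  have s1 : (1.4 : ℝ) < √2 := Real.lt_sqrt_of_sq_lt (by norm_num)
  have s3 : √2 < (1.42 : ℝ) := by rw [Real.sqrt_lt' (by norm_num)]; norm_num
  have hbR : (1 : ℝ) ≤ b := by exact_mod_cast hb
  have hneg : ((a : ℝ) - b * √2) ^ p = - (b * √2 - a) ^ p := by
    rw [← hodd.neg_pow]; congr 1; ring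
  rw [hneg] at hT
  rcases le_or_gt 0 a with ha | ha
  · have haR : (0 : ℝ) ≤ a := by exact_mod_cast ha
    have hu : √2 ≤ (a : ℝ) + b * √2 := by nlinarith
    have h1 : (b * √2 - a) ^ p ≤ ((a : ℝ) + b * √2) ^ p := by
      rw [← sub_nonneg]
      have := (hodd.strictMono_pow (R := ℝ)).monotone
        (show (b * √2 - a : ℝ) ≤ (a : ℝ) + b * √2 by linarith)
      simpa using this
    have h2 : √2 ^ 3 ≤ ((a : ℝ) + b * √2) ^ p := by
      calc √2 ^ 3 ≤ √2 ^ p := pow_le_pow_right₀ (by linarith) hp3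
        _ ≤ _ := pow_le_pow_left₀ (by linarith) hu p
    have h3 : √2 ^ 3 = 2 * √2 := by rw [pow_succ, sq, s2]
    nlinarith
  · have hle : b ≤ 1 - a := Int.le_of_dvd (by omega) ((dvd_neg.2 hd).trans (by simp))
    have hα : b ≤ 2 * (-a) := by omega
    have hαR : (b : ℝ) ≤ 2 * (-a) := by exact_mod_cast hα
    have haR : (a : ℝ) < 0 := by exact_mod_cast ha
    have h0 : 0 < (b : ℝ) * √2 - a := by nlinarith
    have hm : 2 * ((a : ℝ) + b * √2) ≤ b * √2 - a := by nlinarith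
    have h1 : (2 * ((a : ℝ) + b * √2)) ^ p ≤ (b * √2 - a) ^ p :=
      (hodd.strictMono_pow (R := ℝ)).monotone hm
    rw [mul_pow] at h1
    have h8 : (8 : ℝ) ≤ 2 ^ p := by
      calc (8 : ℝ) = 2 ^ 3 := by norm_num
        _ ≤ 2 ^ p := pow_le_pow_right₀ (by norm_num) hp3
    have hV : 0 < ((b : ℝ) * √2 - a) ^ p := pow_pos h0 p
    set U := ((a : ℝ) + b * √2) ^ p
    set V := ((b : ℝ) * √2 - a) ^ p
    rcases le_or_gt U 0 with hU | hU
    · nlinarith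
    · have h9 : 8 * U ≤ V := by nlinarith
      nlinarith

/-- Case `b < 0`, written with `b = -c`. -/
theorem aux_neg (p : ℕ) (hp3 : 3 ≤ p) (hodd : Odd p) (a c : ℤ) (hc : 0 < c)
    (hT : (1 + √2) * ((a : ℝ) - c * √2) ^ p + (√2 - 1) * ((a : ℝ) + c * √2) ^ p = 2 * √2) :
    0 < a ∧ a < c := by
  have s2 : √2 * √2 = (2 : ℝ) := Real.mul_self_sqrt (by norm_num)
  have s1 : (1.4 : ℝ) < √2 := Real.lt_sqrt_of_sq_lt (by norm_num)
  have s3 : √2 < (1.42 : ℝ) := by rw [Real.sqrt_lt' (by norm_num)]; norm_num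
  have hcR : (1 : ℝ) ≤ c := by exact_mod_cast hc
  have hneg : ((a : ℝ) - c * √2) ^ p = - (c * √2 - a) ^ p := by
    rw [← hodd.neg_pow]; congr 1; ring
  rw [hneg] at hT
  constructor
  · by_contra ha
    have haR : (a : ℝ) ≤ 0 := by exact_mod_cast not_lt.1 ha
    have h1 : ((a : ℝ) + c * √2) ^ p ≤ (c * √2 - a) ^ p :=
      (hodd.strictMono_pow (R := ℝ)).monotone (show (a : ℝ) + c * √2 ≤ c * √2 - a by linarith)
    have h2 : 0 < ((c : ℝ) * √2 - a) ^ p := pow_pos (by nlinarith) p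
    nlinarith
  · by_contra ha
    have haR : (c : ℝ) ≤ a := by exact_mod_cast not_lt.1 ha
    obtain ⟨n, rfl⟩ : ∃ n, p = n + 3 := ⟨p - 3, by omega⟩
    have h1 : ((c : ℝ) * √2 - a) ^ (n + 3) ≤ (√2 - 1) ^ (n + 3) * (c : ℝ) ^ (n + 3) := by
      rw [← mul_pow]
      exact (hodd.strictMono_pow (R := ℝ)).monotone
        (show (c : ℝ) * √2 - a ≤ (√2 - 1) * c by linarith)
    have h2 : (√2 + 1) ^ (n + 3) * (c : ℝ) ^ (n + 3) ≤ ((a : ℝ) + c * √2) ^ (n + 3) := by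
      rw [← mul_pow]
      exact pow_le_pow_left₀ (by positivity) (by linarith) _
    have hC : (1 : ℝ) ≤ (c : ℝ) ^ (n + 3) := one_le_pow₀ hcR
    have h3 : (√2 - 1) ^ (n + 3) ≤ (√2 - 1) ^ 3 :=
      pow_le_pow_of_le_one (by linarith) (by linarith) (by omega)
    have h4 : (√2 + 1) ^ 3 ≤ (√2 + 1) ^ (n + 3) :=
      pow_le_pow_right₀ (by linarith) (by omega)
    have h5 : (√2 - 1) ^ 3 = 5 * √2 - 7 := by linear_combination (√2 - 3) * s2
    have h6 : (√2 + 1) ^ 3 = 5 * √2 + 7 := by linear_combination (√2 + 3) * s2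
    rw [h5] at h3
    rw [h6] at h4
    set C := (c : ℝ) ^ (n + 3)
    have h7 : ((c : ℝ) * √2 - a) ^ (n + 3) ≤ (5 * √2 - 7) * C :=
      h1.trans (mul_le_mul_of_nonneg_right h3 (by linarith))
    have h8 : (5 * √2 + 7) * C ≤ ((a : ℝ) + c * √2) ^ (n + 3) :=
      (mul_le_mul_of_nonneg_right h4 (by linarith)).trans h2
    have h9 := mul_le_mul_of_nonneg_left h7 (show 0 ≤ 1 + √2 by linarith)
    have h10 := mul_le_mul_of_nonneg_left h8 (show 0 ≤ √2 - 1 by linarith)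
    have h11 : (1 + √2) * ((5 * √2 - 7) * C) = (3 - 2 * √2) * C := by
      linear_combination 5 * C * s2
    have h12 : (√2 - 1) * ((5 * √2 + 7) * C) = (3 + 2 * √2) * C := by
      linear_combination 5 * C * s2
    nlinarith

theorem prime_divisor_of_b (p : ℕ) (hp : p.Prime) (hp3 : 3 ≤ p)
    (x y : ℤ) (h : x ^ 2 - 2 = y ^ p) (hy : y ≠ -1)
    (a b : ℤ)
    (hfact : (x : ℝ) + Real.sqrt 2 =
      (1 + Real.sqrt 2) * ((a : ℝ) + (b : ℝ) * Real.sqrt 2) ^ p) :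
    ∃ ℓ : ℕ, ℓ.Prime ∧ (ℓ : ℤ) ∣ b ∧ ℓ ≡ 1 [MOD p] := by
  have hodd : Odd p := hp.odd_of_ne_two (by omega)
  have hpp : Prime (p : ℤ) := Nat.prime_iff_prime_int.1 hp
  by_contra hcon
  push Not at hcon
  have hZ : (⟨x, 1⟩ : ℤ√2) = ⟨1, 1⟩ * ⟨a, b⟩ ^ p := by
    apply Zsqrtd.toReal_injective (d := 2) (by norm_num)
    · intro n hn
      have h1 : n < 2 := by nlinarith
      have h2 : -2 < n := by nlinarith
      interval_cases n <;> omega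
    · rw [map_mul, map_pow]
      simp only [Zsqrtd.toReal_apply]
      push_cast
      simpa using hfact
  have hconj : (x : ℝ) - √2 = (1 - √2) * ((a : ℝ) - b * √2) ^ p := by
    have := congrArg (fun z => Zsqrtd.toReal (d := 2) (by norm_num) (star z)) hZ
    simp only [star_mul, star_pow, map_mul, map_pow, Zsqrtd.toReal_apply, Zsqrtd.re_star,
      Zsqrtd.im_star] at this
    push_cast at this
    linear_combination this
  have hT : (1 + √2) * ((a : ℝ) + b * √2) ^ p + (√2 - 1) * ((a : ℝ) - b * √2) ^ p = 2 * √2 := by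
    linear_combination hconj - hfact
  obtain ⟨M, hM⟩ := aux_binom p hp hp3 (a : ℤ√2) (⟨0, b⟩ : ℤ√2)
  obtain ⟨k, hk⟩ := hodd
  have hpow : (⟨0, b⟩ : ℤ√2) ^ p = ⟨0, b ^ p * 2 ^ k⟩ := by
    have h2 : (⟨0, b⟩ : ℤ√2) ^ 2 = ((b ^ 2 * 2 : ℤ) : ℤ√2) := by
      rw [sq]; ext <;> simp [-Int.cast_mul, -Int.cast_pow]; ring
    rw [hk, pow_succ, pow_mul, h2, ← Int.cast_pow]
    obtain ⟨c, hc⟩ : ∃ c : ℤ, c = (b ^ 2 * 2) ^ k := ⟨_, rfl⟩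
    rw [← hc]
    ext
    · simp
    · simp; rw [hc]; ring
  have hsum : (a : ℤ√2) + ⟨0, b⟩ = ⟨a, b⟩ := by ext <;> simp
  have hsq : (⟨0, b⟩ : ℤ√2) ^ 2 = ((b ^ 2 * 2 : ℤ) : ℤ√2) := by
    rw [sq]; ext <;> simp [-Int.cast_mul, -Int.cast_pow]; ring
  have hExp : a ^ p + p * a ^ (p - 1) * b + p * (2 * b ^ 2) * (M.re + M.im) + b ^ p * 2 ^ k = 1 := by
    rw [hsum, hpow, hsq, ← Int.cast_natCast (R := ℤ√2), ← Int.cast_pow, ← Int.cast_pow,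
      ← Int.cast_mul, ← Int.cast_mul] at hM
    have him := congrArg Zsqrtd.im hZ
    rw [hM] at him
    obtain ⟨c, hc⟩ : ∃ c : ℤ, c = a ^ p := ⟨_, rfl⟩
    rw [← hc] at him ⊢
    simp [-Int.cast_mul, -Int.cast_pow] at him
    linarith
  have hodd : Odd p := ⟨k, hk⟩
  have hbp : b ^ p = b * b * b ^ (p - 2) := by
    rw [← sq, ← pow_add]; congr 1; omega
  by_cases hb0 : b = 0
  · subst hb0
    have ha : a ^ p = 1 := by
      rw [zero_pow hp.ne_zero] at hExp; simpa using hExp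
    have haR : (a : ℝ) ^ p = 1 := by exact_mod_cast ha
    have hx : (x : ℝ) = 1 := by
      simp [haR] at hfact; simp [hfact]
    have hx' : x = 1 := by exact_mod_cast hx
    subst hx'
    apply hy
    apply hodd.strictMono_pow.injective
    simp only [hodd.neg_one_pow]
    linarith
  have hd : b ∣ a - 1 := by
    apply aux_dvd p hp hp3 a b (-(p * a ^ (p - 1) + p * (2 * b) * (M.re + M.im)
        + b * b ^ (p - 2) * 2 ^ k))
    · rw [hbp] at hExp; linear_combination hExp
    · intro hpb
      rw [dvd_neg]
      refine dvd_add (dvd_add ?_ ?_) ?_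
      · exact Dvd.intro _ rfl
      · exact ⟨2 * b * (M.re + M.im), by ring⟩
      · exact Dvd.dvd.mul_right (Dvd.dvd.mul_right hpb _) _
    · exact hcon
  rcases lt_or_gt_of_ne hb0 with hb | hb
  · obtain ⟨h1, h2⟩ := aux_neg p hp3 hodd a (-b) (by omega) (by
      push_cast
      rw [← hT]; ring)
    have ha1 : a = 1 := by
      have := Int.eq_zero_of_dvd_of_nonneg_of_lt (by omega : 0 ≤ a - 1) (by omega : a - 1 < -b)
        ((neg_dvd).2 hd)
      omega
    subst ha1
    obtain ⟨m, rfl⟩ : ∃ m, p = m + 3 := ⟨p - 3, by omega⟩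
    have h3 : ((m + 3 : ℕ) : ℤ) + (m + 3 : ℕ) * (2 * b) * (M.re + M.im)
        + b * (b * b ^ m * 2 ^ k) = 0 := by
      apply mul_left_cancel₀ hb0
      simp only [one_pow] at hExp
      linear_combination hExp
    have hbd : b ∣ ((m + 3 : ℕ) : ℤ) :=
      ⟨-((m + 3 : ℕ) * 2 * (M.re + M.im) + (b * b ^ m * 2 ^ k)), by linear_combination h3⟩
    have hbn : b.natAbs ∣ m + 3 := by
      have := Int.natAbs_dvd_natAbs.2 hbd
      rwa [Int.natAbs_natCast] at this
    rcases (Nat.dvd_prime hp).1 hbn with h4 | h4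
    · omega
    · have hbe : b = -((m + 3 : ℕ) : ℤ) := by omega
      generalize ((m + 3 : ℕ) : ℤ) = P at *
      subst hbe
      apply hpp.not_dvd_one
      refine ⟨2 * (M.re + M.im) - (-P) ^ m * 2 ^ k, ?_⟩
      apply mul_left_cancel₀ hpp.ne_zero
      linear_combination h3
  · exact aux_pos p hp3 hodd a b hb hd hT
end
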